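/- Let M be a compact Riemannian manifold of nonpositive sectional curvature. Suppose cyclic pursuit on M with initial positions {b_i(0)}_{i∈ℤ/n} does not end in finite time, and let β^t be the associated family of piecewise geodesic loops. Then there is a closed geodesic α : ℝ/ℤ → M such that β^t → α as t → ∞, i.e. inf_{c∈ℝ} sup_{s∈ℝ/ℤ} d(β^t(s), α(s+c)) → 0. Equivalently, the loop of bugs either collapses to a point in finite time or converges to a closed geodesic. -/

import Mathlib

open Set Filter Metric Asymptotics Function
open scoped Topology Real

/-!  A synthetic framework for Riemannian manifolds with positive injectivity radius,
formulated on a metric space `M`.  `injAt p` is the injectivity radius at the point `p`,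
`inj` (the injectivity radius of `M`) is a lower bound for it, and whenever
`dist p q < injAt p` there is a unique shortest geodesic `[p,q]` from `p` to `q`,
parameterized at constant speed on `[0,1]`, denoted `geod p q`. -/
structure GeodesicStructure (M : Type*) [MetricSpace M] where
  /-- the injectivity radius `inj M` of the manifold -/
  inj : ℝ
  /-- the injectivity radius at a point -/
  injAt : M → ℝ
  inj_le_injAt : ∀ p, inj ≤ injAt p
  /-- `geod p q` is the shortest geodesic `[p,q] : [0,1] → M` (junk unless
  `dist p q < injAt p`). -/
  geod : M → M → ℝ → M
  geod_zero : ∀ p q, dist p q < injAt p → geod p q 0 = p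
  geod_one : ∀ p q, dist p q < injAt p → geod p q 1 = q
  geod_dist : ∀ p q, dist p q < injAt p → ∀ s ∈ Icc (0:ℝ) 1, ∀ u ∈ Icc (0:ℝ) 1,
    dist (geod p q s) (geod p q u) = |s - u| * dist p q
  geod_unique : ∀ p q, dist p q < injAt p → ∀ γ : ℝ → M, γ 0 = p → γ 1 = q →
    (∀ s ∈ Icc (0:ℝ) 1, ∀ u ∈ Icc (0:ℝ) 1, dist (γ s) (γ u) = |s - u| * dist p q) →
    ∀ s ∈ Icc (0:ℝ) 1, γ s = geod p q s

variable {M : Type*} [MetricSpace M]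

/-- **Cyclic pursuit on a Riemannian manifold** `M` with `inj M > 0`, with initial
positions satisfying `dist (b i 0) (b (i+1) 0) < inj M`:  a collection of (piecewise
smooth, in particular continuous) curves `b i : [0,∞) → M`, `i ∈ ℤ/n`, such that
(1) whenever `b i t ≠ b (i+1) t`, bug `i` moves with unit speed along the shortest
    geodesic towards bug `i+1`; metrically: `b i (t+h)` agrees to first order (as
    `h → 0⁺`) with the point at arclength parameter `h` along the unique shortest
    geodesic from `b i t` to `b (i+1) t` — i.e. the velocity of `b i` at `t` is the
    initial unit tangent vector of that geodesic;
(2) bugs that have met stay together;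
(3) once all the bugs coincide, they halt. -/
structure IsCyclicPursuit (G : GeodesicStructure M) (n : ℕ) (b : ZMod n → ℝ → M) :
    Prop where
  init_sep : ∀ i, dist (b i 0) (b (i + 1) 0) < G.inj
  cont : ∀ i, ContinuousOn (b i) (Ici 0)
  chase : ∀ (i : ZMod n) (t : ℝ), 0 ≤ t → b i t ≠ b (i + 1) t →
    dist (b i t) (b (i + 1) t) < G.injAt (b i t) →
    (fun h : ℝ => dist (b i (t + h))
        (G.geod (b i t) (b (i + 1) t) (h / dist (b i t) (b (i + 1) t))))
      =o[𝓝[≥] (0:ℝ)] (fun h => h)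
  merge : ∀ (i : ZMod n) (t₀ : ℝ), 0 ≤ t₀ → b i t₀ = b (i + 1) t₀ →
    ∀ t, t₀ < t → b i t = b (i + 1) t
  halt : ∀ t₀ : ℝ, 0 ≤ t₀ → (∀ i, b i t₀ = b 0 t₀) → ∀ t, t₀ < t → ∀ i, b i t = b 0 t₀

/-- `β : ℝ/ℤ → M` (a `1`-periodic map `ℝ → M`) is the constant-speed piecewise geodesic
loop through the cyclic configuration `b : ℤ/n → M`: it traverses the shortest geodesics
`[b i, b (i+1)]`, `i = 0, …, n-1`, in order, each parameterized proportionally to its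
length, with `β 0 = b 0`. -/
def IsPursuitLoop (G : GeodesicStructure M) {n : ℕ} [NeZero n]
    (b : ZMod n → M) (β : ℝ → M) : Prop :=
  Function.Periodic β 1 ∧ β 0 = b 0 ∧
  ∃ σ : ℕ → ℝ, σ 0 = 0 ∧ σ n = 1 ∧ Monotone σ ∧
    (∀ i : ℕ, i < n →
      (σ (i + 1) - σ i) * (∑ j : ZMod n, dist (b j) (b (j + 1)))
        = dist (b (i : ZMod n)) (b ((i : ZMod n) + 1))) ∧
    (∀ i : ℕ, i < n → ∀ s ∈ Icc (σ i) (σ (i + 1)),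
      β s = G.geod (b (i : ZMod n)) (b ((i : ZMod n) + 1)) ((s - σ i) / (σ (i + 1) - σ i)))

/-- A **closed geodesic** of length `L`, parameterized proportionally to arclength by
`ℝ/ℤ` (a `1`-periodic map `ℝ → M`): it is nonconstant and locally an isometry up to the
scale factor `L` (every Riemannian geodesic is locally length-minimizing, and conversely). -/
def IsClosedGeodesic (α : ℝ → M) (L : ℝ) : Prop :=
  Function.Periodic α 1 ∧ 0 < L ∧
    ∃ e > (0:ℝ), ∀ s u : ℝ, |s - u| ≤ e → dist (α s) (α u) = L * |s - u|

/-- Convergence `β t → α` as `t → ∞` of a family of loops to a loop, in the quotient of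
`C⁰(S¹, M)` by rotations of the domain:  `inf_{c} sup_{s} d (β t s) (α (s + c)) → 0`. -/
def LoopTendsto (β : ℝ → ℝ → M) (α : ℝ → M) : Prop :=
  ∀ ε > (0:ℝ), ∃ T : ℝ, ∀ t : ℝ, T ≤ t → ∃ c : ℝ, ∀ s : ℝ, dist (β t s) (α (s + c)) < ε

/-- The comparison (Euclidean) angle at `p` of the triangle `p x y`. -/
noncomputable def comparisonAngle (p x y : M) : ℝ :=
  Real.arccos ((dist p x ^ 2 + dist p y ^ 2 - dist x y ^ 2) / (2 * dist p x * dist p y))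

/-- The angle at `p` between the shortest geodesics `[p, q₁]` and `[p, q₂]`, defined
synthetically as the limit of comparison angles. -/
noncomputable def GeodesicStructure.angle (G : GeodesicStructure M) (p q₁ q₂ : M) : ℝ :=
  limsup (fun s : ℝ => comparisonAngle p (G.geod p q₁ s) (G.geod p q₂ s)) (𝓝[>] (0:ℝ))

/-- Synthetic rendering of "`U` has **nonpositive sectional curvature**": for any two
geodesics whose images lie in `U` and which are joined through `U` (as in the second
variation argument), the distance between corresponding points is a convex function of
the parameter. -/
def NonposCurvedOn (G : GeodesicStructure M) (U : Set M) : Prop :=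
  ∀ p₁ p₂ q₁ q₂ : M, dist p₁ p₂ < G.injAt p₁ → dist q₁ q₂ < G.injAt q₁ →
    (∀ s ∈ Icc (0:ℝ) 1, G.geod p₁ p₂ s ∈ U) →
    (∀ s ∈ Icc (0:ℝ) 1, G.geod q₁ q₂ s ∈ U) →
    (∀ s ∈ Icc (0:ℝ) 1, dist (G.geod p₁ p₂ s) (G.geod q₁ q₂ s)
        < G.injAt (G.geod p₁ p₂ s)) →
    (∀ s ∈ Icc (0:ℝ) 1, ∀ u ∈ Icc (0:ℝ) 1,
        G.geod (G.geod p₁ p₂ s) (G.geod q₁ q₂ s) u ∈ U) →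
    ConvexOn ℝ (Icc (0:ℝ) 1) (fun s => dist (G.geod p₁ p₂ s) (G.geod q₁ q₂ s))

/-- The two curves `γ₁, γ₂` (on `[0,1]`) lie along a common geodesic. -/
def OnSameGeodesic (G : GeodesicStructure M) (γ₁ γ₂ : ℝ → M) : Prop :=
  ∃ (a c : M) (x₁ y₁ x₂ y₂ : ℝ), dist a c < G.injAt a ∧
    (∀ s ∈ Icc (0:ℝ) 1, γ₁ s = G.geod a c (x₁ + y₁ * s)) ∧
    (∀ s ∈ Icc (0:ℝ) 1, γ₂ s = G.geod a c (x₂ + y₂ * s))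

/-- Synthetic rendering of "`U` has **negative sectional curvature**": in addition to the
convexity above, the squared distance between corresponding points of two geodesics in `U`
is *strictly* convex, unless the two geodesics lie along a common geodesic. -/
def NegCurvedOn (G : GeodesicStructure M) (U : Set M) : Prop :=
  NonposCurvedOn G U ∧
  ∀ p₁ p₂ q₁ q₂ : M, dist p₁ p₂ < G.injAt p₁ → dist q₁ q₂ < G.injAt q₁ →
    (∀ s ∈ Icc (0:ℝ) 1, G.geod p₁ p₂ s ∈ U) →
    (∀ s ∈ Icc (0:ℝ) 1, G.geod q₁ q₂ s ∈ U) →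
    (∀ s ∈ Icc (0:ℝ) 1, dist (G.geod p₁ p₂ s) (G.geod q₁ q₂ s)
        < G.injAt (G.geod p₁ p₂ s)) →
    (∀ s ∈ Icc (0:ℝ) 1, ∀ u ∈ Icc (0:ℝ) 1,
        G.geod (G.geod p₁ p₂ s) (G.geod q₁ q₂ s) u ∈ U) →
    ¬ OnSameGeodesic G (G.geod p₁ p₂) (G.geod q₁ q₂) →
    StrictConvexOn ℝ (Icc (0:ℝ) 1)
      (fun s => dist (G.geod p₁ p₂ s) (G.geod q₁ q₂ s) ^ 2)



namespace PursuitAux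

theorem geod_self (G : GeodesicStructure M) (hinj : 0 < G.inj) (z : M) {u : ℝ}
    (hu : u ∈ Icc (0:ℝ) 1) : G.geod z z u = z := by
  have h0 : dist z z < G.injAt z := by
    rw [dist_self]; exact lt_of_lt_of_le hinj (G.inj_le_injAt z)
  have h1 := G.geod_dist z z h0 u hu 0 (by simp)
  rw [dist_self, mul_zero, G.geod_zero z z h0] at h1
  exact dist_eq_zero.1 h1

theorem lt_injAt (G : GeodesicStructure M) {x : ℝ} (p : M) (h : x < G.inj) : x < G.injAt p :=
  lt_of_lt_of_le h (G.inj_le_injAt p)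

theorem cvx_pt (G : GeodesicStructure M) (hinj : 0 < G.inj) (hnp : NonposCurvedOn G Set.univ)
    (p q z : M) (hpq : dist p q < G.inj)
    (hz : ∀ u ∈ Icc (0:ℝ) 1, dist (G.geod p q u) z < G.inj) {l m : ℝ}
    (hl : 0 ≤ l) (hlm : l ≤ m) (hm0 : 0 < m) (hm : m ≤ 1) :
    dist (G.geod p q l) z ≤ dist p z + (l / m) * (dist (G.geod p q m) z - dist p z) := by
  have hc := hnp p q z z (lt_injAt G p hpq) (lt_injAt G z (by simpa using hinj))
    (fun _ _ => mem_univ _) (fun _ _ => mem_univ _)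
    (fun s hs => by rw [geod_self G hinj z hs]; exact lt_injAt G _ (hz s hs))
    (fun _ _ _ _ => mem_univ _)
  have h := hc.2 (show (0:ℝ) ∈ Icc (0:ℝ) 1 by simp) (show m ∈ Icc (0:ℝ) 1 from ⟨hm0.le, hm⟩)
    (show 0 ≤ 1 - l / m by rw [sub_nonneg]; exact div_le_one_of_le₀ hlm hm0.le)
    (show 0 ≤ l / m by positivity) (by ring)
  simp only [smul_eq_mul, mul_zero, zero_add] at h
  rw [div_mul_cancel₀ _ hm0.ne', geod_self G hinj z ⟨hl, hlm.trans hm⟩,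
    geod_self G hinj z (by simp), geod_self G hinj z ⟨hm0.le, hm⟩,
    G.geod_zero p q (lt_injAt G p hpq)] at h
  linarith

theorem cvx_two (G : GeodesicStructure M) (hnp : NonposCurvedOn G Set.univ)
    (p q p' q' : M) {k m : ℝ} (hpq : dist p q ≤ k) (hpq' : dist p' q' ≤ k)
    (hp : dist p p' ≤ m) (hq : dist q q' ≤ m) (hkm : k + m < G.inj) {u : ℝ}
    (hu : u ∈ Icc (0:ℝ) 1) :
    dist (G.geod p q u) (G.geod p' q' u) ≤ m := by
  have hk0 : 0 ≤ k := dist_nonneg.trans hpq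
  have hm0 : 0 ≤ m := dist_nonneg.trans hp
  have h1 : dist p q < G.injAt p := lt_injAt G p (by linarith)
  have h2 : dist p' q' < G.injAt p' := lt_injAt G p' (by linarith)
  have hc := hnp p q p' q' h1 h2
    (fun _ _ => mem_univ _) (fun _ _ => mem_univ _)
    (fun s hs => by
      apply lt_injAt G
      rcases le_total s (1/2) with h | h
      · have e1 := G.geod_dist p q h1 s hs 0 (by simp)
        have e2 := G.geod_dist p' q' h2 0 (by simp) s hs
        rw [G.geod_zero _ _ h1, sub_zero, abs_of_nonneg hs.1] at e1
        rw [G.geod_zero _ _ h2, zero_sub, abs_neg, abs_of_nonneg hs.1] at e2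
        have := dist_triangle4 (G.geod p q s) p p' (G.geod p' q' s)
        have a1 : s * dist p q ≤ 1/2 * k := mul_le_mul h hpq dist_nonneg (by norm_num)
        have a2 : s * dist p' q' ≤ 1/2 * k := mul_le_mul h hpq' dist_nonneg (by norm_num)
        linarith
      · have e1 := G.geod_dist p q h1 s hs 1 (by simp)
        have e2 := G.geod_dist p' q' h2 1 (by simp) s hs
        rw [G.geod_one _ _ h1, abs_sub_comm, abs_of_nonneg (by linarith [hs.2])] at e1
        rw [G.geod_one _ _ h2, abs_of_nonneg (by linarith [hs.2])] at e2
        have := dist_triangle4 (G.geod p q s) q q' (G.geod p' q' s)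
        have a1 : (1 - s) * dist p q ≤ 1/2 * k :=
          mul_le_mul (by linarith) hpq dist_nonneg (by norm_num)
        have a2 : (1 - s) * dist p' q' ≤ 1/2 * k :=
          mul_le_mul (by linarith) hpq' dist_nonneg (by norm_num)
        linarith)
    (fun _ _ _ _ => mem_univ _)
  have h := hc.2 (show (0:ℝ) ∈ Icc (0:ℝ) 1 by simp) (show (1:ℝ) ∈ Icc (0:ℝ) 1 by simp)
    (show 0 ≤ 1 - u by linarith [hu.2]) hu.1 (by ring)
  simp only [smul_eq_mul, mul_zero, zero_add, mul_one] at h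
  rw [G.geod_zero _ _ h1, G.geod_zero _ _ h2, G.geod_one _ _ h1, G.geod_one _ _ h2] at h
  have := hu.1
  have := hu.2
  nlinarith

/-- A one-sided Dini derivative bound implies a growth bound. -/
theorem dini (f : ℝ → ℝ) {a b : ℝ} (hab : a ≤ b) (hf : ContinuousOn f (Icc a b)) (g : ℝ)
    (H : ∀ t ∈ Ico a b, ∀ c > 0, ∀ᶠ h in 𝓝[>] (0:ℝ), f (t + h) ≤ f t + h * (g + c)) :
    f b ≤ f a + g * (b - a) := by
  suffices hs : ∀ c > 0, f b ≤ f a + (g + c) * (b - a) by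
    refine le_of_forall_pos_le_add fun ε hε => ?_
    have := hs (ε / (b - a + 1)) (div_pos hε (by linarith))
    have h2 : ε / (b - a + 1) * (b - a) ≤ ε := by
      rw [div_mul_eq_mul_div, div_le_iff₀ (by linarith)]
      nlinarith
    nlinarith
  intro c hc
  have key : Icc a b ⊆ {t | f t ≤ f a + (g + c) * (t - a)} := by
    apply IsClosed.Icc_subset_of_forall_exists_gt
    · have : {t | f t ≤ f a + (g + c) * (t - a)} ∩ Icc a b
          = {t ∈ Icc a b | f t ≤ f a + (g + c) * (t - a)} := by
        ext; simp [and_comm]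
      rw [this]
      exact isClosed_Icc.isClosed_le hf (by fun_prop)
    · simp
    · rintro x ⟨hx, hxab⟩ y hy
      have h1 := H x hxab c hc
      have h2 : ∀ᶠ h in 𝓝[>] (0:ℝ), h ∈ Ioo 0 (y - x) :=
        Ioo_mem_nhdsGT (sub_pos.2 hy)
      obtain ⟨h, hh1, hh2⟩ := (h1.and h2).exists
      refine ⟨x + h, ?_, ?_, ?_⟩
      · simp only [mem_ofPred_eq] at hx ⊢
        linarith
      · linarith [hh2.1]
      · linarith [hh2.2]
  exact key ⟨hab, le_refl b⟩

/-- The pursuit, indexed by natural numbers. -/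
structure Purs (G : GeodesicStructure M) (n : ℕ) (B : ℕ → ℝ → M) : Prop where
  npos : 0 < n
  injpos : 0 < G.inj
  np : NonposCurvedOn G Set.univ
  per : ∀ i t, B (i + n) t = B i t
  init : ∀ i, dist (B i 0) (B (i + 1) 0) < G.inj
  cont : ∀ i, ContinuousOn (B i) (Ici 0)
  chase : ∀ i t, 0 ≤ t → B i t ≠ B (i + 1) t → dist (B i t) (B (i + 1) t) < G.inj →
    ∀ c > 0, ∀ᶠ h in 𝓝[>] (0:ℝ), dist (B i (t + h))
      (G.geod (B i t) (B (i + 1) t) (h / dist (B i t) (B (i + 1) t))) ≤ c * h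
  merge : ∀ i t₀ t, 0 ≤ t₀ → t₀ ≤ t → B i t₀ = B (i + 1) t₀ → B i t = B (i + 1) t
  alive : ∀ t, 0 ≤ t → ∃ i, B i t ≠ B (i + 1) t

namespace Purs

variable {G : GeodesicStructure M} {n : ℕ} {B : ℕ → ℝ → M}

theorem per_mul (P : Purs G n B) (i k : ℕ) (t : ℝ) : B (i + k * n) t = B i t := by
  induction k with
  | zero => simp
  | succ k ih => rw [Nat.succ_mul, ← add_assoc, P.per, ih]

theorem red (P : Purs G n B) (i : ℕ) :
    ∃ r < n, (∀ t, B i t = B r t) ∧ (∀ t, B (i + 1) t = B (r + 1) t) := by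
  refine ⟨i % n, Nat.mod_lt _ P.npos, fun t => ?_, fun t => ?_⟩
  · conv_lhs => rw [← Nat.mod_add_div' i n]
    exact P.per_mul _ _ _
  · conv_lhs => rw [← Nat.mod_add_div' i n, add_right_comm]
    exact P.per_mul _ _ _

theorem follow (P : Purs G n B) {t : ℝ} (ht : 0 ≤ t) (i : ℕ) :
    ∃ j, i ≤ j ∧ B j t ≠ B (j + 1) t ∧ (∀ k, i ≤ k → k < j → B k t = B (k + 1) t) ∧
      ∀ s, t ≤ s → B i s = B j s := by
  classical
  have hex : ∃ j, i ≤ j ∧ B j t ≠ B (j + 1) t := by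
    obtain ⟨i₀, h⟩ := P.alive t ht
    refine ⟨i₀ + i * n, ?_, ?_⟩
    · have := P.npos; nlinarith
    · rw [add_right_comm, P.per_mul, P.per_mul]; exact h
  have hmin : ∀ k, i ≤ k → k < Nat.find hex → B k t = B (k + 1) t := by
    intro k hk hk2
    by_contra hne
    exact Nat.find_min hex hk2 ⟨hk, hne⟩
  refine ⟨Nat.find hex, (Nat.find_spec hex).1, (Nat.find_spec hex).2, hmin, ?_⟩
  intro s hs
  have : ∀ k, i ≤ k → k ≤ Nat.find hex → B i s = B k s := by
    intro k hk
    induction k, hk using Nat.le_induction with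
    | base => intro _; rfl
    | succ k hk ih =>
      intro h2
      rw [ih (by omega)]
      exact P.merge k t s ht hs (hmin k hk (by omega))
  exact this _ (Nat.find_spec hex).1 le_rfl

theorem ev_small {x : ℝ} (hx : 0 < x) : ∀ᶠ h in 𝓝[>] (0:ℝ), 0 < h ∧ h < x :=
  Ioo_mem_nhdsGT hx

theorem speed_at (P : Purs G n B) {t : ℝ} (ht : 0 ≤ t)
    (hs : ∀ i, dist (B i t) (B (i + 1) t) < G.inj) (i : ℕ) {c : ℝ} (hc : 0 < c) :
    ∀ᶠ h in 𝓝[>] (0:ℝ), dist (B i t) (B i (t + h)) ≤ h * (1 + c) := by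
  obtain ⟨j, -, hj, -, hij⟩ := P.follow ht i
  have hd : 0 < dist (B j t) (B (j + 1) t) := dist_pos.2 hj
  filter_upwards [P.chase j t ht hj (hs j) c hc, ev_small hd] with h h1 h2
  rw [hij t le_rfl, hij (t + h) (by linarith)]
  have e := G.geod_dist _ _ (lt_injAt G _ (hs j)) 0 (by simp)
    (h / dist (B j t) (B (j + 1) t)) ⟨by have := h2.1; positivity, div_le_one_of_le₀ h2.2.le hd.le⟩
  rw [G.geod_zero _ _ (lt_injAt G _ (hs j)), zero_sub, abs_neg,
    abs_of_nonneg (by have := h2.1; positivity), div_mul_cancel₀ _ hd.ne'] at e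
  have := dist_triangle_right (B j t) (B j (t + h))
    (G.geod (B j t) (B (j + 1) t) (h / dist (B j t) (B (j + 1) t)))
  linarith

theorem len_at (P : Purs G n B) {t : ℝ} (ht : 0 ≤ t)
    (hs : ∀ i, dist (B i t) (B (i + 1) t) < G.inj) (i : ℕ) {c : ℝ} (hc : 0 < c) :
    ∀ᶠ h in 𝓝[>] (0:ℝ), dist (B i (t + h)) (B (i + 1) (t + h)) ≤
      dist (B i t) (B (i + 1) t) + h * c := by
  by_cases hj : B i t = B (i + 1) t
  · filter_upwards [ev_small one_pos] with h h2
    rw [P.merge i t (t + h) ht (by linarith) hj, dist_self]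
    have := h2.1
    positivity
  have hd : 0 < dist (B i t) (B (i + 1) t) := dist_pos.2 hj
  filter_upwards [P.chase i t ht hj (hs i) (c/2) (by linarith), ev_small hd,
    P.speed_at ht hs (i+1) (c := c/2) (by linarith)] with h h1 h2 h3
  have e := G.geod_dist _ _ (lt_injAt G _ (hs i))
    (h / dist (B i t) (B (i + 1) t)) ⟨by have := h2.1; positivity, div_le_one_of_le₀ h2.2.le hd.le⟩
    1 (by simp)
  rw [G.geod_one _ _ (lt_injAt G _ (hs i)), abs_sub_comm, abs_of_nonneg
    (sub_nonneg.2 (div_le_one_of_le₀ h2.2.le hd.le)), sub_mul, div_mul_cancel₀ _ hd.ne'] at e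
  have := dist_triangle4 (B i (t + h)) (G.geod (B i t) (B (i + 1) t)
    (h / dist (B i t) (B (i + 1) t))) (B (i + 1) t) (B (i + 1) (t + h))
  linarith

theorem cont_dist (P : Purs G n B) (i j : ℕ) :
    ContinuousOn (fun t => dist (B i t) (B j t)) (Ici 0) :=
  continuous_dist.comp_continuousOn ((P.cont i).prodMk (P.cont j))

theorem sep (P : Purs G n B) {t : ℝ} (ht : 0 ≤ t) (i : ℕ) :
    dist (B i t) (B (i + 1) t) < G.inj := by
  obtain ⟨δ, hδ, hδi⟩ : ∃ δ > 0, ∀ i, dist (B i 0) (B (i + 1) 0) + δ * t < G.inj := by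
    have h1 : ∀ i ∈ Finset.range n, ∀ᶠ δ in 𝓝[>] (0:ℝ),
        dist (B i 0) (B (i + 1) 0) + δ * t < G.inj := by
      intro i _
      have : Tendsto (fun δ : ℝ => dist (B i 0) (B (i + 1) 0) + δ * t) (𝓝[>] 0)
          (𝓝 (dist (B i 0) (B (i + 1) 0) + 0 * t)) :=
        Tendsto.mono_left (Continuous.tendsto (by fun_prop) 0) nhdsWithin_le_nhds
      exact this.eventually_lt_const (by simpa using P.init i)
    obtain ⟨δ, h2, h3⟩ := (((Filter.eventually_all_finset _).2 h1).and
      (ev_small one_pos)).exists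
    refine ⟨δ, h3.1, fun i => ?_⟩
    obtain ⟨r, hr, e1, e2⟩ := P.red i
    rw [e1, e2]
    exact h2 r (Finset.mem_range.2 hr)
  have key : Icc 0 t ⊆ {s | ∀ i, dist (B i s) (B (i + 1) s) ≤
      dist (B i 0) (B (i + 1) 0) + δ * s} := by
    apply IsClosed.Icc_subset_of_forall_exists_gt
    · have : {s | ∀ i, dist (B i s) (B (i + 1) s) ≤
          dist (B i 0) (B (i + 1) 0) + δ * s} ∩ Icc 0 t
          = ⋂ i, {s ∈ Icc 0 t | dist (B i s) (B (i + 1) s) ≤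
          dist (B i 0) (B (i + 1) 0) + δ * s} := by
        ext s; simp only [mem_inter_iff, mem_ofPred_eq, mem_iInter]
        exact ⟨fun h i => ⟨h.2, h.1 i⟩, fun h => ⟨fun i => (h i).2, (h 0).1⟩⟩
      rw [this]
      exact isClosed_iInter fun i => isClosed_Icc.isClosed_le
        ((P.cont_dist i (i+1)).mono Icc_subset_Ici_self) (by fun_prop)
    · simp
    · rintro x ⟨hx, hxab⟩ y hy
      simp only [mem_ofPred_eq] at hx
      have hsx : ∀ i, dist (B i x) (B (i + 1) x) < G.inj := fun i =>
        lt_of_le_of_lt (hx i) (lt_of_le_of_lt (by nlinarith [hxab.2]) (hδi i))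
      have h1 := (Filter.eventually_all_finset (Finset.range n)).2
        (fun i _ => P.len_at hxab.1 hsx i hδ)
      obtain ⟨h, hh1, hh2⟩ := (h1.and (ev_small (sub_pos.2 hy))).exists
      refine ⟨x + h, ?_, ?_, ?_⟩
      · intro i
        obtain ⟨r, hr, e1, e2⟩ := P.red i
        have a := hh1 r (Finset.mem_range.2 hr)
        have a' := hx r
        rw [e1, e2, e1, e2]
        linarith
      · linarith [hh2.1]
      · linarith [hh2.2]
  exact lt_of_le_of_lt (key ⟨ht, le_rfl⟩ i) (hδi i)

theorem speed (P : Purs G n B) {s t : ℝ} (hs : 0 ≤ s) (hst : s ≤ t) (i : ℕ) :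
    dist (B i s) (B i t) ≤ t - s := by
  have := dini (fun x => dist (B i s) (B i x)) hst
    ((continuous_dist.comp_continuousOn (continuousOn_const.prodMk (P.cont i))).mono (fun x hx => hs.trans hx.1)) 1 (by
      intro x hx c hc
      filter_upwards [P.speed_at (hs.trans hx.1) (P.sep (hs.trans hx.1)) i hc] with h h1
      have := dist_triangle (B i s) (B i x) (B i (x + h))
      linarith)
  simp at this
  linarith

theorem len_anti (P : Purs G n B) {s t : ℝ} (hs : 0 ≤ s) (hst : s ≤ t) (i : ℕ) :
    dist (B i t) (B (i + 1) t) ≤ dist (B i s) (B (i + 1) s) := by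
  have := dini (fun x => dist (B i x) (B (i + 1) x)) hst
    ((P.cont_dist i (i+1)).mono (fun x hx => hs.trans hx.1)) 0 (by
      intro x hx c hc
      filter_upwards [P.len_at (hs.trans hx.1) (P.sep (hs.trans hx.1)) i hc] with h h1
      simpa using h1)
  simpa using this

theorem bound (P : Purs G n B) : ∃ κ, 0 ≤ κ ∧ κ < G.inj ∧
    ∀ i t, 0 ≤ t → dist (B i t) (B (i + 1) t) ≤ κ := by
  have hne : (Finset.range n).Nonempty := ⟨0, Finset.mem_range.2 P.npos⟩
  obtain ⟨m, hm, hmax⟩ := Finset.exists_max_image (Finset.range n)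
    (fun i => dist (B i 0) (B (i + 1) 0)) hne
  refine ⟨dist (B m 0) (B (m + 1) 0), dist_nonneg, P.init m, fun i t ht => ?_⟩
  obtain ⟨r, hr, e1, e2⟩ := P.red i
  rw [e1, e2]
  exact (P.len_anti le_rfl ht r).trans (hmax r (Finset.mem_range.2 hr))

/-- The evolution variational inequality. -/
theorem evi_at (P : Purs G n B) {t : ℝ} (ht : 0 ≤ t) (i : ℕ) (hi : B i t ≠ B (i + 1) t) (z : M)
    (hz : ∀ u ∈ Icc (0:ℝ) 1, dist (G.geod (B i t) (B (i + 1) t) u) z < G.inj) {l : ℝ}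
    (hl0 : 0 < l) (hl1 : l ≤ 1) {c : ℝ} (hc : 0 < c) :
    ∀ᶠ h in 𝓝[>] (0:ℝ), dist (B i (t + h)) z ≤ dist (B i t) z +
      h * ((dist (G.geod (B i t) (B (i + 1) t) l) z - dist (B i t) z)
        / (l * dist (B i t) (B (i + 1) t)) + c) := by
  have hd : 0 < dist (B i t) (B (i + 1) t) := dist_pos.2 hi
  filter_upwards [P.chase i t ht hi (P.sep ht i) c hc, ev_small (mul_pos hl0 hd)] with h h1 h2
  have hc := cvx_pt G P.injpos P.np _ _ z (P.sep ht i) hz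
    (l := h / dist (B i t) (B (i + 1) t)) (m := l) (by have := h2.1; positivity)
    (by rw [div_le_iff₀ hd]; exact h2.2.le) hl0 hl1
  have := dist_triangle (B i (t + h)) (G.geod (B i t) (B (i + 1) t)
    (h / dist (B i t) (B (i + 1) t))) z
  have e : h / dist (B i t) (B (i + 1) t) / l *
      (dist (G.geod (B i t) (B (i + 1) t) l) z - dist (B i t) z) =
      h * ((dist (G.geod (B i t) (B (i + 1) t) l) z - dist (B i t) z)
        / (l * dist (B i t) (B (i + 1) t))) := by
    field_simp
  rw [e] at hc
  linarith

end Purs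


/-- Length of the `i`-th edge. -/
abbrev ell (B : ℕ → ℝ → M) (i : ℕ) (t : ℝ) : ℝ := dist (B i t) (B (i + 1) t)

/-- Arclength position of the `i`-th bug; `arc B n t` is the total length. -/
abbrev arc (B : ℕ → ℝ → M) (i : ℕ) (t : ℝ) : ℝ := ∑ k ∈ Finset.range i, ell B k t

theorem arc_succ (B : ℕ → ℝ → M) (i : ℕ) (t : ℝ) : arc B (i + 1) t = arc B i t + ell B i t :=
  Finset.sum_range_succ _ _

theorem arc_dist (B : ℕ → ℝ → M) {i j : ℕ} (hij : i ≤ j) (t : ℝ) :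
    dist (B i t) (B j t) ≤ arc B j t - arc B i t := by
  induction j, hij using Nat.le_induction with
  | base => simp
  | succ k hk ih =>
    rw [arc_succ]
    have := dist_triangle (B i t) (B k t) (B (k + 1) t)
    linarith

theorem arc_mono (B : ℕ → ℝ → M) (t : ℝ) : Monotone fun i => arc B i t :=
  monotone_nat_of_le_succ fun i => by
    rw [arc_succ]; linarith [dist_nonneg (x := B i t) (y := B (i + 1) t)]

theorem arc_nonneg (B : ℕ → ℝ → M) (i : ℕ) (t : ℝ) : 0 ≤ arc B i t :=
  Finset.sum_nonneg fun _ _ => dist_nonneg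

namespace Purs

variable {G : GeodesicStructure M} {n : ℕ} {B : ℕ → ℝ → M}

theorem ell_per (P : Purs G n B) (i : ℕ) (t : ℝ) : ell B (i + n) t = ell B i t := by
  simp only [ell]
  rw [add_right_comm, P.per, P.per]

theorem arc_per (P : Purs G n B) (i : ℕ) (t : ℝ) : arc B (i + n) t = arc B i t + arc B n t := by
  induction i with
  | zero => simp [arc]
  | succ i ih => rw [add_right_comm, arc_succ, ih, arc_succ, P.ell_per]; ring

theorem arc_anti (P : Purs G n B) {s t : ℝ} (hs : 0 ≤ s) (hst : s ≤ t) (i : ℕ) :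
    arc B i t ≤ arc B i s :=
  Finset.sum_le_sum fun k _ => P.len_anti hs hst k

theorem ell_le_arc (B : ℕ → ℝ → M) {i : ℕ} (hi : i < n) (t : ℝ) : ell B i t ≤ arc B n t :=
  Finset.single_le_sum (f := fun k => ell B k t) (fun _ _ => dist_nonneg) (Finset.mem_range.2 hi)

theorem dist_le_arc (B : ℕ → ℝ → M) {i j : ℕ} (hi : i < n) (hj : j < n) (t : ℝ) :
    dist (B i t) (B j t) ≤ arc B n t := by
  rcases le_total i j with h | h
  · have h1 := arc_dist B h t
    have h2 := arc_mono B t hj.le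
    have h3 := arc_nonneg B i t
    simp only at h2
    linarith
  · have h1 := arc_dist B h t
    have h2 := arc_mono B t hi.le
    have h3 := arc_nonneg B j t
    simp only at h2
    rw [dist_comm]
    linarith

theorem dist_geod_left (P : Purs G n B) {t : ℝ} (ht : 0 ≤ t) (i : ℕ) {u : ℝ}
    (hu : u ∈ Icc (0:ℝ) 1) :
    dist (G.geod (B i t) (B (i + 1) t) u) (B i t) = u * ell B i t := by
  have e := G.geod_dist _ _ (lt_injAt G _ (P.sep ht i)) u hu 0 (by simp)
  rwa [G.geod_zero _ _ (lt_injAt G _ (P.sep ht i)), sub_zero, abs_of_nonneg hu.1] at e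

theorem dist_geod_right (P : Purs G n B) {t : ℝ} (ht : 0 ≤ t) (i : ℕ) {u : ℝ}
    (hu : u ∈ Icc (0:ℝ) 1) :
    dist (G.geod (B i t) (B (i + 1) t) u) (B (i + 1) t) = (1 - u) * ell B i t := by
  have e := G.geod_dist _ _ (lt_injAt G _ (P.sep ht i)) u hu 1 (by simp)
  rwa [G.geod_one _ _ (lt_injAt G _ (P.sep ht i)), abs_sub_comm,
    abs_of_nonneg (by linarith [hu.2])] at e

theorem pair_at (P : Purs G n B) {t : ℝ} (ht : 0 ≤ t) (hL : 3 * arc B n t < G.inj)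
    {i j : ℕ} (hi : i < n) (hj : j < n) (hi' : B i t ≠ B (i + 1) t) (hj' : B j t ≠ B (j + 1) t)
    {c : ℝ} (hc : 0 < c) :
    ∀ᶠ h in 𝓝[>] (0:ℝ), dist (B i (t + h)) (B j (t + h)) ≤ dist (B i t) (B j t) +
      h * ((dist (B (i + 1) t) (B j t) - dist (B i t) (B j t)) / ell B i t +
        (dist (B i t) (B (j + 1) t) - dist (B i t) (B j t)) / ell B j t + c) := by
  have di : 0 < ell B i t := dist_pos.2 hi'
  have dj : 0 < ell B j t := dist_pos.2 hj'
  filter_upwards [P.chase i t ht hi' (P.sep ht i) (c / 4) (by positivity),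
    P.chase j t ht hj' (P.sep ht j) (c / 4) (by positivity),
    ev_small di, ev_small dj, ev_small (show 0 < c * ell B i t / 4 by positivity)]
    with h h1 h2 h3 h4 h5
  have hh := h3.1
  have hl : h / ell B i t ∈ Icc (0:ℝ) 1 := ⟨by positivity, div_le_one_of_le₀ h3.2.le di.le⟩
  have hm : h / ell B j t ∈ Icc (0:ℝ) 1 := ⟨by positivity, div_le_one_of_le₀ h4.2.le dj.le⟩
  have Li := ell_le_arc B hi t
  have Lj := ell_le_arc B hj t
  have Lij := dist_le_arc B hi hj t
  set x := G.geod (B i t) (B (i + 1) t) (h / ell B i t) with hx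
  set y := G.geod (B j t) (B (j + 1) t) (h / ell B j t) with hy
  have dy : dist y (B j t) = h := by
    rw [hy, P.dist_geod_left ht j hm, div_mul_cancel₀ _ dj.ne']
  have c1 := cvx_pt G P.injpos P.np (B i t) (B (i + 1) t) y (P.sep ht i) (fun u hu => by
      have e := P.dist_geod_left ht i hu
      have := dist_triangle4_right (G.geod (B i t) (B (i + 1) t) u) (B i t) y (B j t)
      have e2 : u * ell B i t ≤ 1 * ell B i t := mul_le_mul_of_nonneg_right hu.2 di.le
      have := dist_triangle (G.geod (B i t) (B (i + 1) t) u) (B i t) y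
      have := dist_triangle_right (B i t) y (B j t)
      linarith) hl.1 hl.2 one_pos le_rfl
  have c2 := cvx_pt G P.injpos P.np (B j t) (B (j + 1) t) (B i t) (P.sep ht j) (fun u hu => by
      have e := P.dist_geod_left ht j hu
      have e2 : u * ell B j t ≤ 1 * ell B j t := mul_le_mul_of_nonneg_right hu.2 dj.le
      have := dist_triangle (G.geod (B j t) (B (j + 1) t) u) (B j t) (B i t)
      rw [dist_comm (B j t) (B i t)] at this
      linarith) hm.1 hm.2 one_pos le_rfl
  rw [G.geod_one _ _ (lt_injAt G _ (P.sep ht i)), div_one, ← hx] at c1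
  rw [G.geod_one _ _ (lt_injAt G _ (P.sep ht j)), div_one, ← hy, dist_comm y,
    dist_comm (B j t) (B i t), dist_comm (B (j + 1) t) (B i t)] at c2
  have a1 : dist (B (i + 1) t) y - dist (B i t) y ≤
      dist (B (i + 1) t) (B j t) - dist (B i t) (B j t) + 2 * h := by
    have := dist_triangle_right (B (i + 1) t) y (B j t)
    have := dist_triangle (B i t) y (B j t)
    linarith
  have a2 := mul_le_mul_of_nonneg_left a1 hl.1
  have a3 : h / ell B i t * (2 * h) ≤ h * (c / 2) := by
    rw [div_mul_eq_mul_div, div_le_iff₀ di]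
    nlinarith [h5.2]
  have tri := dist_triangle4_right (B i (t + h)) (B j (t + h)) x y
  have e1 : h * ((dist (B (i + 1) t) (B j t) - dist (B i t) (B j t)) / ell B i t +
        (dist (B i t) (B (j + 1) t) - dist (B i t) (B j t)) / ell B j t + c) =
      h / ell B i t * (dist (B (i + 1) t) (B j t) - dist (B i t) (B j t)) +
      h / ell B j t * (dist (B i t) (B (j + 1) t) - dist (B i t) (B j t)) + h * c := by
    ring
  rw [e1]
  have tri2 := dist_triangle4 (B i (t + h)) x y (B j (t + h))
  rw [dist_comm y] at tri2
  linarith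

/-- The Lyapunov function. -/
abbrev lyap (B : ℕ → ℝ → M) (n : ℕ) (t : ℝ) : ℝ :=
  ∑ i ∈ Finset.range n, ∑ j ∈ Finset.range n, ell B i t * ell B j t * dist (B i t) (B j t)

theorem lyap_term_at (P : Purs G n B) {t : ℝ} (ht : 0 ≤ t) (hL : 3 * arc B n t < G.inj)
    {i j : ℕ} (hi : i < n) (hj : j < n) {c : ℝ} (hc : 0 < c) :
    ∀ᶠ h in 𝓝[>] (0:ℝ),
      ell B i (t + h) * ell B j (t + h) * dist (B i (t + h)) (B j (t + h)) ≤
      ell B i t * ell B j t * dist (B i t) (B j t) +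
      h * ((ell B j t * (dist (B (i + 1) t) (B j t) - dist (B i t) (B j t)) +
        ell B i t * (dist (B i t) (B (j + 1) t) - dist (B i t) (B j t)) -
        (if i = j then 2 * ell B i t ^ 2 else 0)) + c) := by
  by_cases hij : i = j
  · subst hij
    filter_upwards [ev_small one_pos] with h h2
    have := h2.1
    have e : dist (B (i + 1) t) (B i t) = ell B i t := dist_comm _ _
    simp only [dist_self, mul_zero, zero_add, if_true, sub_zero, e]
    have : 0 ≤ h * c := by positivity
    nlinarith
  rw [if_neg hij, sub_zero]
  by_cases hi' : B i t = B (i + 1) t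
  · filter_upwards [ev_small one_pos] with h h2
    have := h2.1
    have e : ell B i (t + h) = 0 := dist_eq_zero.2 (P.merge i t (t + h) ht (by linarith) hi')
    have e' : ell B i t = 0 := dist_eq_zero.2 hi'
    rw [e, e', ← hi']
    simp only [zero_mul, sub_self, mul_zero, zero_add]
    positivity
  by_cases hj' : B j t = B (j + 1) t
  · filter_upwards [ev_small one_pos] with h h2
    have := h2.1
    have e : ell B j (t + h) = 0 := dist_eq_zero.2 (P.merge j t (t + h) ht (by linarith) hj')
    have e' : ell B j t = 0 := dist_eq_zero.2 hj'
    rw [e, e', ← hj']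
    simp only [zero_mul, sub_self, mul_zero, zero_add]
    positivity
  have di : 0 < ell B i t := dist_pos.2 hi'
  have dj : 0 < ell B j t := dist_pos.2 hj'
  filter_upwards [P.pair_at ht hL hi hj hi' hj'
    (show 0 < c / (ell B i t * ell B j t) by positivity), ev_small one_pos] with h h1 h2
  have a1 := P.len_anti ht (show t ≤ t + h by linarith) i
  have a2 := P.len_anti ht (show t ≤ t + h by linarith) j
  calc ell B i (t + h) * ell B j (t + h) * dist (B i (t + h)) (B j (t + h))
      ≤ ell B i t * ell B j t * dist (B i (t + h)) (B j (t + h)) := by gcongr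
    _ ≤ _ := mul_le_mul_of_nonneg_left h1 (by positivity)
    _ = _ := by field_simp

theorem lyap_at (P : Purs G n B) {t : ℝ} (ht : 0 ≤ t) (hL : 3 * arc B n t < G.inj)
    {c : ℝ} (hc : 0 < c) :
    ∀ᶠ h in 𝓝[>] (0:ℝ), lyap B n (t + h) ≤ lyap B n t +
      h * (-2 * (∑ j ∈ Finset.range n, ell B j t ^ 2) + c) := by
  have hn := P.npos
  have hn' : (0:ℝ) < n := by exact_mod_cast hn
  have H : ∀ i ∈ Finset.range n, ∀ᶠ h in 𝓝[>] (0:ℝ), ∀ j ∈ Finset.range n,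
      ell B i (t + h) * ell B j (t + h) * dist (B i (t + h)) (B j (t + h)) ≤
      ell B i t * ell B j t * dist (B i t) (B j t) +
      h * ((ell B j t * (dist (B (i + 1) t) (B j t) - dist (B i t) (B j t)) +
        ell B i t * (dist (B i t) (B (j + 1) t) - dist (B i t) (B j t)) -
        (if i = j then 2 * ell B i t ^ 2 else 0)) + c / (n * n)) := fun i hi =>
    (Filter.eventually_all_finset _).2 fun j hj =>
      P.lyap_term_at ht hL (Finset.mem_range.1 hi) (Finset.mem_range.1 hj) (by positivity)
  filter_upwards [(Filter.eventually_all_finset _).2 H] with h hh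
  refine (Finset.sum_le_sum fun i hi => Finset.sum_le_sum fun j hj => hh i hi j hj).trans ?_
  apply le_of_eq
  simp only [Finset.sum_add_distrib, ← Finset.mul_sum]
  congr 2
  have e1 : ∑ i ∈ Finset.range n, ∑ j ∈ Finset.range n,
      ell B j t * (dist (B (i + 1) t) (B j t) - dist (B i t) (B j t)) = 0 := by
    rw [Finset.sum_comm]
    refine Finset.sum_eq_zero fun j _ => ?_
    rw [← Finset.mul_sum, Finset.sum_range_sub (fun i => dist (B i t) (B j t))]
    have := P.per 0 t
    rw [zero_add] at this
    rw [this, sub_self, mul_zero]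
  have e2 : ∑ i ∈ Finset.range n, ∑ j ∈ Finset.range n,
      ell B i t * (dist (B i t) (B (j + 1) t) - dist (B i t) (B j t)) = 0 := by
    refine Finset.sum_eq_zero fun i _ => ?_
    rw [← Finset.mul_sum, Finset.sum_range_sub (fun j => dist (B i t) (B j t))]
    have := P.per 0 t
    rw [zero_add] at this
    rw [this, sub_self, mul_zero]
  have e3 : ∑ i ∈ Finset.range n, ∑ j ∈ Finset.range n,
      (if i = j then 2 * ell B i t ^ 2 else 0) = 2 * ∑ i ∈ Finset.range n, ell B i t ^ 2 := by
    rw [Finset.mul_sum]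
    refine Finset.sum_congr rfl fun i hi => ?_
    rw [Finset.sum_ite_eq, if_pos hi]
  have e4 : ∑ i ∈ Finset.range n, ∑ j ∈ Finset.range n, c / ((n:ℝ) * n) = c := by
    simp only [Finset.sum_const, Finset.card_range, nsmul_eq_mul]
    field_simp
  simp only [Finset.mul_sum] at e1 e2 e3 e4 ⊢
  simp only [Finset.sum_sub_distrib, Finset.sum_add_distrib, neg_mul, Finset.sum_neg_distrib] at e1 e2 e3 e4 ⊢
  linarith

theorem lyap_decay (P : Purs G n B) {s t : ℝ} (hs : 0 ≤ s) (hst : s ≤ t)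
    (hL : 3 * arc B n s < G.inj) :
    2 * (t - s) * arc B n t ^ 2 ≤ n * arc B n s ^ 3 := by
  have hn := P.npos
  have hn' : (0:ℝ) < n := by exact_mod_cast hn
  have h1 := dini (lyap B n) hst (by
      apply ContinuousOn.mono (s := Ici 0) _ (fun x hx => hs.trans hx.1)
      refine continuousOn_finsetSum _ fun i _ => continuousOn_finsetSum _ fun j _ => ?_
      exact ((P.cont_dist _ _).mul (P.cont_dist _ _)).mul (P.cont_dist _ _))
    (-2 * (∑ j ∈ Finset.range n, ell B j t ^ 2)) (by
      intro x hx c hc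
      have hx0 := hs.trans hx.1
      have hLx : 3 * arc B n x < G.inj := by
        have := P.arc_anti hs hx.1 n
        linarith
      filter_upwards [P.lyap_at hx0 hLx hc, ev_small one_pos] with h h1 h2
      refine h1.trans ?_
      have : ∑ j ∈ Finset.range n, ell B j t ^ 2 ≤ ∑ j ∈ Finset.range n, ell B j x ^ 2 := by
        refine Finset.sum_le_sum fun j _ => ?_
        have := P.len_anti hx0 hx.2.le j
        gcongr
      have hh := mul_le_mul_of_nonneg_left this h2.1.le
      linarith)
  have h2 : 0 ≤ lyap B n t := Finset.sum_nonneg fun i _ => Finset.sum_nonneg fun j _ => by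
    positivity
  have h3 : lyap B n s ≤ arc B n s ^ 3 := by
    have : arc B n s ^ 3 = ∑ i ∈ Finset.range n, ∑ j ∈ Finset.range n,
        ell B i s * ell B j s * arc B n s := by
      simp only [← Finset.sum_mul, ← Finset.mul_sum]
      ring
    rw [this]
    refine Finset.sum_le_sum fun i hi => Finset.sum_le_sum fun j hj => ?_
    have := dist_le_arc B (Finset.mem_range.1 hi) (Finset.mem_range.1 hj) s
    gcongr
  have h4 : arc B n t ^ 2 ≤ n * ∑ j ∈ Finset.range n, ell B j t ^ 2 := by
    have := sq_sum_le_card_mul_sum_sq (s := Finset.range n) (f := fun j => ell B j t)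
    rwa [Finset.card_range] at this
  have h5 : 2 * (t - s) * (∑ j ∈ Finset.range n, ell B j t ^ 2) ≤ arc B n s ^ 3 := by linarith
  calc 2 * (t - s) * arc B n t ^ 2
      ≤ 2 * (t - s) * (n * ∑ j ∈ Finset.range n, ell B j t ^ 2) := by
        have := sub_nonneg.2 hst
        gcongr
    _ = n * (2 * (t - s) * (∑ j ∈ Finset.range n, ell B j t ^ 2)) := by ring
    _ ≤ _ := by gcongr

theorem arc_pos (P : Purs G n B) {t : ℝ} (ht : 0 ≤ t) : 0 < arc B n t := by
  obtain ⟨i, hi⟩ := P.alive t ht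
  obtain ⟨r, hr, e1, e2⟩ := P.red i
  rw [e1, e2] at hi
  exact lt_of_lt_of_le (dist_pos.2 hi) (ell_le_arc B hr t)

/-- The length cannot become small without finite-time collapse. -/
theorem arc_lower (P : Purs G n B) {t : ℝ} (ht : 0 ≤ t) : G.inj / 3 ≤ arc B n t := by
  by_contra hlt
  push Not at hlt
  have hn := P.npos
  have hn' : (0:ℝ) < n := by exact_mod_cast hn
  set L := arc B n t with hLdef
  have hL0 : 0 ≤ L := arc_nonneg _ _ _
  have key : ∀ k : ℕ, arc B n (t + 4 * n * L * (1 - (1/2)^k)) ≤ L * (1/2)^k := by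
    intro k
    induction k with
    | zero => simp [hLdef]
    | succ k ih =>
      have hq : (0:ℝ) < (1/2)^k := by positivity
      have hq1 : ((1:ℝ)/2)^k ≤ 1 := pow_le_one₀ (by norm_num) (by norm_num)
      set q := ((1:ℝ)/2)^k with hqdef
      have hs : t ≤ t + 4 * n * L * (1 - q) := by
        have : 0 ≤ 4 * n * L * (1 - q) := mul_nonneg (by positivity) (by linarith)
        linarith
      have hp : ((1:ℝ)/2)^(k+1) = q / 2 := by rw [pow_succ]; ring
      rw [hp]
      have hst : t + 4 * n * L * (1 - q) ≤ t + 4 * n * L * (1 - q / 2) := by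
        have : 0 ≤ 4 * n * L * q := by positivity
        nlinarith
      have hanti := P.arc_anti ht hs n
      have hd := P.lyap_decay (ht.trans hs) hst (by linarith)
      have hpos := P.arc_pos ht
      rw [← hLdef] at hpos
      have hA := P.arc_pos (ht.trans (hs.trans hst))
      set A := arc B n (t + 4 * n * L * (1 - q / 2))
      set A' := arc B n (t + 4 * n * L * (1 - q))
      have hA' : 0 ≤ A' := arc_nonneg _ _ _
      have h3 : A' ^ 3 ≤ (L * q) ^ 3 := by gcongr
      have h4 : 2 * (t + 4 * n * L * (1 - q / 2) - (t + 4 * n * L * (1 - q))) * A ^ 2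
          = (n * (L * q)) * (4 * A ^ 2) := by ring
      rw [h4] at hd
      have h5 : (n * (L * q)) * (4 * A ^ 2) ≤ (n * (L * q)) * (L * q) ^ 2 := by
        refine hd.trans ?_
        have : n * A' ^ 3 ≤ n * (L * q) ^ 3 := by gcongr
        refine this.trans (le_of_eq (by ring))
      have h6 := le_of_mul_le_mul_left h5 (by positivity)
      have h7 : (2 * A) ^ 2 ≤ (L * q) ^ 2 := by linarith
      have := abs_le_of_sq_le_sq h7 (by positivity)
      linarith [(le_abs_self _).trans this]
  have hT : 0 ≤ t + 4 * n * L := by positivity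
  have h1 : ∀ k : ℕ, arc B n (t + 4 * n * L) ≤ L * (1/2)^k := fun k => by
    have hq : (0:ℝ) < (1/2)^k := by positivity
    have hq1 : ((1:ℝ)/2)^k ≤ 1 := pow_le_one₀ (by norm_num) (by norm_num)
    refine (P.arc_anti ?_ ?_ n).trans (key k)
    · have : 0 ≤ 4 * n * L * (1 - (1/2)^k) := mul_nonneg (by positivity) (by linarith)
      linarith
    · have : 0 ≤ 4 * n * L * (1/2)^k := by positivity
      nlinarith
  have h2 : Tendsto (fun k : ℕ => L * (1/2:ℝ)^k) atTop (𝓝 (L * 0)) :=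
    (tendsto_pow_atTop_nhds_zero_of_lt_one (by norm_num) (by norm_num)).const_mul _
  have := ge_of_tendsto' h2 h1
  have := P.arc_pos hT
  linarith

end Purs


/-- Limit length of the `i`-th edge. -/
noncomputable def ellI (B : ℕ → ℝ → M) (i : ℕ) : ℝ := ⨅ t : ℝ, ell B i (max t 0)

/-- Limit arclength position of the `i`-th bug. -/
noncomputable def arcI (B : ℕ → ℝ → M) (i : ℕ) : ℝ := ∑ k ∈ Finset.range i, ellI B k

theorem arcI_succ (B : ℕ → ℝ → M) (i : ℕ) : arcI B (i + 1) = arcI B i + ellI B i :=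
  Finset.sum_range_succ _ _

theorem ellI_nonneg (B : ℕ → ℝ → M) (i : ℕ) : 0 ≤ ellI B i := le_ciInf fun _ => dist_nonneg

theorem ellI_le (B : ℕ → ℝ → M) (i : ℕ) {t : ℝ} (ht : 0 ≤ t) : ellI B i ≤ ell B i t := by
  have : BddBelow (range fun t : ℝ => ell B i (max t 0)) := ⟨0, by
    rintro _ ⟨x, rfl⟩; exact dist_nonneg⟩
  have h := ciInf_le this t
  simp only [max_eq_left ht] at h
  exact h

theorem arcI_mono (B : ℕ → ℝ → M) : Monotone (arcI B) :=
  monotone_nat_of_le_succ fun i => by rw [arcI_succ]; linarith [ellI_nonneg B i]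

namespace Purs

variable {G : GeodesicStructure M} {n : ℕ} {B : ℕ → ℝ → M}

theorem tendsto_ell (P : Purs G n B) (i : ℕ) : Tendsto (ell B i) atTop (𝓝 (ellI B i)) := by
  have : BddBelow (range fun t : ℝ => ell B i (max t 0)) := ⟨0, by
    rintro _ ⟨x, rfl⟩; exact dist_nonneg⟩
  have h := tendsto_atTop_ciInf (f := fun t : ℝ => ell B i (max t 0)) (fun s t hst =>
    P.len_anti (le_max_right s 0) (max_le_max_right 0 hst) i) this
  refine h.congr' ?_
  filter_upwards [eventually_ge_atTop 0] with t ht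
  rw [max_eq_left ht]

theorem tendsto_arc (P : Purs G n B) (i : ℕ) : Tendsto (arc B i) atTop (𝓝 (arcI B i)) :=
  tendsto_finsetSum _ fun k _ => P.tendsto_ell k

theorem arcI_lower (P : Purs G n B) : G.inj / 3 ≤ arcI B n :=
  ge_of_tendsto (P.tendsto_arc n) (by
    filter_upwards [eventually_ge_atTop 0] with t ht using P.arc_lower ht)

theorem arcI_pos (P : Purs G n B) : 0 < arcI B n := by
  have := P.arcI_lower
  have := P.injpos
  linarith

theorem ellI_per (P : Purs G n B) (i : ℕ) : ellI B (i + n) = ellI B i := by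
  simp only [ellI, P.ell_per]

theorem arcI_per (P : Purs G n B) (i : ℕ) : arcI B (i + n) = arcI B i + arcI B n := by
  induction i with
  | zero => simp [arcI]
  | succ i ih => rw [add_right_comm, arcI_succ, ih, arcI_succ, P.ellI_per]; ring

theorem arcI_le_arc (B : ℕ → ℝ → M) (i : ℕ) {t : ℝ} (ht : 0 ≤ t) : arcI B i ≤ arc B i t :=
  Finset.sum_le_sum fun k _ => ellI_le B k ht

/-- Prey position in the future is far from the hunter position now. -/
theorem future (P : Purs G n B) {κ : ℝ} (hκ : ∀ i t, 0 ≤ t → dist (B i t) (B (i + 1) t) ≤ κ)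
    (i : ℕ) (he : 0 < ellI B i) {t h : ℝ} (ht : 0 ≤ t) (hh : 0 < h) (hs : κ + h < G.inj) :
    ellI B i + h - 2 * h ^ 2 / ellI B i ≤ dist (B i t) (B (i + 1) (t + h)) := by
  have hpos : ∀ s, 0 ≤ s → 0 < dist (B i s) (B (i + 1) s) := fun s hs' =>
    lt_of_lt_of_le he (ellI_le B i hs')
  have h1 := dini (fun s => dist (B i s) (B (i + 1) (t + h))) (show t ≤ t + h by linarith) (by
      apply ContinuousOn.mono (s := Ici 0) _ (fun x hx => ht.trans hx.1)
      exact continuous_dist.comp_continuousOn ((P.cont i).prodMk continuousOn_const))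
    (-1 + 2 * h / ellI B i) (by
      intro s hs' c hc
      have hs0 := ht.trans hs'.1
      have sp := P.speed hs0 hs'.2.le (i + 1)
      have hd := hpos s hs0
      filter_upwards [P.evi_at hs0 i (dist_pos.1 hd) (B (i + 1) (t + h)) (fun u hu => by
          have e := P.dist_geod_right hs0 i hu
          have e2 : (1 - u) * ell B i s ≤ 1 * ell B i s :=
            mul_le_mul_of_nonneg_right (by linarith [hu.1]) dist_nonneg
          have := hκ i s hs0
          have := dist_triangle (G.geod (B i s) (B (i + 1) s) u) (B (i + 1) s) (B (i + 1) (t + h))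
          have := hs'.1
          simp only [ell] at e e2
          linarith) one_pos le_rfl hc, ev_small one_pos] with k hk hk'
      refine hk.trans ?_
      rw [G.geod_one _ _ (lt_injAt G _ (P.sep hs0 i)), one_mul]
      have tri := dist_triangle_right (B i s) (B (i + 1) s) (B (i + 1) (t + h))
      have a : (dist (B (i + 1) s) (B (i + 1) (t + h)) - dist (B i s) (B (i + 1) (t + h))) /
          dist (B i s) (B (i + 1) s) ≤ -1 + 2 * h / ellI B i := by
        have b1 : 2 * h / dist (B i s) (B (i + 1) s) ≤ 2 * h / ellI B i := by
          have := ellI_le B i hs0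
          gcongr
        refine le_trans ?_ (add_le_add_right b1 (-1))
        rw [div_le_iff₀ hd, add_mul, div_mul_cancel₀ _ hd.ne']
        have := hs'.1
        linarith
      have := hk'.1
      gcongr)
  have h2 := ellI_le B i (show 0 ≤ t + h by linarith)
  simp only [ell] at h2
  have h3 : (-1 + 2 * h / ellI B i) * (t + h - t) = - h + 2 * h ^ 2 / ellI B i := by
    field_simp
    ring
  linarith

theorem corner_aux (P : Purs G n B) {κ : ℝ}
    (hκ : ∀ i t, 0 ≤ t → dist (B i t) (B (i + 1) t) ≤ κ)
    (i j : ℕ) (he : 0 < ellI B i) (hf : 0 < ellI B j)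
    (hij : Tendsto (fun t => dist (B (i + 1) t) (B j t)) atTop (𝓝 0))
    {μ l : ℝ} (hμ0 : 0 < μ) (hμ1 : μ ≤ 1) (hl0 : 0 < l) (hl1 : l ≤ 1) (hμκ : κ + μ * κ < G.inj)
    {ε : ℝ} (hε : 0 < ε) (hε' : ε ≤ l * ellI B j) :
    ∀ᶠ t in atTop, μ * ellI B i + l * ellI B j - ε ≤
      dist (G.geod (B i t) (B (i + 1) t) (1 - μ)) (G.geod (B j t) (B (j + 1) t) l) := by
  set e := ellI B i with hedef
  set f := ellI B j with hfdef
  set η := ε / (2 * (l * f)) with hη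
  have hη0 : 0 < η := by positivity
  obtain ⟨h, hh0, hh1⟩ : ∃ h, 0 < h ∧ h < min (η / 8 * e) (min (ε / 8) ((G.inj - κ - μ * κ) / 2)) :=
    exists_between (by
      refine lt_min (by positivity) (lt_min (by positivity) (by linarith)))
  rw [lt_min_iff, lt_min_iff] at hh1
  obtain ⟨hha, hhb, hhc⟩ := hh1
  set ε1 := min (h * η / 16) (min (ε / 4) ((G.inj - κ - μ * κ) / 2)) with hε1
  have hε1p : 0 < ε1 := by
    refine lt_min (by positivity) (lt_min (by positivity) (by linarith))
  have hx1 : ε1 ≤ h * η / 16 := min_le_left _ _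
  have hx2 : ε1 ≤ ε / 4 := (min_le_right _ _).trans (min_le_left _ _)
  have hx3 : ε1 ≤ (G.inj - κ - μ * κ) / 2 := (min_le_right _ _).trans (min_le_right _ _)
  have hκ0 : 0 ≤ κ := dist_nonneg.trans (hκ 0 0 le_rfl)
  have hμk : 0 ≤ μ * κ := by positivity
  obtain ⟨T, hT⟩ := eventually_atTop.1 (hij.eventually_lt_const hε1p)
  have hell := (P.tendsto_ell i).eventually_lt_const
    (show ellI B i < e + h * η / 4 by have : 0 < h * η := by positivity
                                      linarith)
  filter_upwards [eventually_ge_atTop T, eventually_ge_atTop 0, hell] with t htT ht hei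
  by_contra hX
  push Not at hX
  set p' := G.geod (B i t) (B (i + 1) t) (1 - μ) with hp'
  have hmem : 1 - μ ∈ Icc (0:ℝ) 1 := ⟨by linarith, by linarith⟩
  have hlmem : l ∈ Icc (0:ℝ) 1 := ⟨hl0.le, hl1⟩
  have dl : dist p' (B i t) = (1 - μ) * ell B i t := P.dist_geod_left ht i hmem
  have dr : dist p' (B (i + 1) t) = μ * ell B i t := by
    rw [hp', P.dist_geod_right ht i hmem]; ring
  have hee := ellI_le B i ht
  have hμe : μ * e ≤ μ * ell B i t := mul_le_mul_of_nonneg_left hee hμ0.le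
  have hμκ' : μ * ell B i t ≤ μ * κ := mul_le_mul_of_nonneg_left (hκ i t ht) hμ0.le
  have hij0 := hT t htT
  have fut := P.future hκ i he ht hh0 (by linarith)
  -- growth of the distance
  have h1 := dini (fun s => dist (B j s) p') (show t ≤ t + h by linarith) (by
      apply ContinuousOn.mono (s := Ici 0) _ (fun x hx => ht.trans hx.1)
      exact continuous_dist.comp_continuousOn ((P.cont j).prodMk continuousOn_const))
    (1 - η) (by
      intro s hs' c hc
      have hs0 := ht.trans hs'.1
      have hs2 := hs'.2
      have hs1 := hs'.1
      have sp := P.speed ht hs'.1 j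
      have sp' := P.speed ht hs'.1 (j + 1)
      have hfs := ellI_le B j hs0
      have hd : 0 < dist (B j s) (B (j + 1) s) := lt_of_lt_of_le hf hfs
      have t1 := dist_triangle4 (B j s) (B j t) (B (i + 1) t) p'
      rw [dist_comm (B j s) (B j t), dist_comm (B j t) (B (i + 1) t), dist_comm (B (i + 1) t) p'] at t1
      filter_upwards [P.evi_at hs0 j (dist_pos.1 hd) p' (fun u hu => by
          have e := P.dist_geod_left hs0 j hu
          have e2 : u * ell B j s ≤ 1 * ell B j s :=
            mul_le_mul_of_nonneg_right hu.2 dist_nonneg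
          have := hκ j s hs0
          have := dist_triangle (G.geod (B j s) (B (j + 1) s) u) (B j s) p'
          simp only [ell] at e e2
          linarith) hl0 hl1 hc, ev_small one_pos] with k hk hk'
      refine hk.trans ?_
      have cv := cvx_two G P.np (B j s) (B (j + 1) s) (B j t) (B (j + 1) t) (k := κ) (m := h)
        (hκ j s hs0) (hκ j t ht) (by rw [dist_comm]; linarith) (by rw [dist_comm]; linarith)
        (by linarith) hlmem
      have t2 := dist_triangle (G.geod (B j s) (B (j + 1) s) l)
        (G.geod (B j t) (B (j + 1) t) l) p'
      rw [dist_comm (G.geod (B j t) (B (j + 1) t) l) p'] at t2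
      have t3 := dist_triangle4 p' (B j s) (B j t) (B (i + 1) t)
      rw [dist_comm p' (B j s), dist_comm (B j s) (B j t),
        dist_comm (B j t) (B (i + 1) t)] at t3
      have a : (dist (G.geod (B j s) (B (j + 1) s) l) p' - dist (B j s) p') /
          (l * dist (B j s) (B (j + 1) s)) ≤ 1 - η := by
        have b0 : 1 - η = (l * f - ε / 2) / (l * f) := by
          rw [hη]; field_simp
        have b1 : (l * f - ε / 2) / (l * dist (B j s) (B (j + 1) s)) ≤ 1 - η := by
          rw [b0]
          have : l * f ≤ l * dist (B j s) (B (j + 1) s) := mul_le_mul_of_nonneg_left hfs hl0.le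
          apply div_le_div_of_nonneg_left (by linarith) (by positivity) this
        refine le_trans ?_ b1
        apply div_le_div_of_nonneg_right _ (by positivity)
        linarith
      have := hk'.1
      gcongr)
  have t4 := dist_triangle4 (B i t) p' (B j (t + h)) (B (i + 1) (t + h))
  have hij1 := hT (t + h) (by linarith)
  have t5 := dist_triangle (B j t) (B (i + 1) t) p'
  rw [dist_comm (B j t) (B (i + 1) t), dist_comm (B (i + 1) t) p'] at t5
  rw [dist_comm (B i t) p', dist_comm p' (B j (t + h)),
    dist_comm (B j (t + h)) (B (i + 1) (t + h))] at t4
  have h6 : (1 - η) * (t + h - t) = h - h * η := by ring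
  rw [h6] at h1
  have h7 : 2 * h ^ 2 / e ≤ h * η / 4 := by
    rw [div_le_iff₀ he]
    nlinarith
  have h8 : 0 < h * η := by positivity
  rw [← hedef] at fut
  linarith

theorem corner (P : Purs G n B) {κ : ℝ}
    (hκ : ∀ i t, 0 ≤ t → dist (B i t) (B (i + 1) t) ≤ κ)
    (i j : ℕ) (he : 0 < ellI B i) (hf : 0 < ellI B j)
    (hij : Tendsto (fun t => dist (B (i + 1) t) (B j t)) atTop (𝓝 0))
    {μ l : ℝ} (hμ0 : 0 < μ) (hμ1 : μ ≤ 1) (hl0 : 0 < l) (hl1 : l ≤ 1) (hμκ : κ + μ * κ < G.inj)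
    {ε : ℝ} (hε : 0 < ε) :
    ∀ᶠ t in atTop, μ * ellI B i + l * ellI B j - ε ≤
      dist (G.geod (B i t) (B (i + 1) t) (1 - μ)) (G.geod (B j t) (B (j + 1) t) l) := by
  filter_upwards [P.corner_aux hκ i j he hf hij hμ0 hμ1 hl0 hl1 hμκ
    (lt_min hε (show 0 < l * ellI B j by positivity)) (min_le_right _ _)] with t ht
  have := min_le_left ε (l * ellI B j)
  linarith

end Purs


theorem nat_switch (p : ℕ → Prop) (h0 : ¬ p 0) (h : ∃ N, p N) : ∃ i, ¬ p i ∧ p (i + 1) := by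
  classical
  obtain ⟨k, hk⟩ : ∃ k, Nat.find h = k + 1 := Nat.exists_eq_succ_of_ne_zero fun e => by
    have := Nat.find_spec h
    rw [e] at this
    exact h0 this
  exact ⟨k, Nat.find_min h (by omega), by rw [← hk]; exact Nat.find_spec h⟩

/-- The loops associated with the pursuit. -/
structure Loops (G : GeodesicStructure M) (n : ℕ) (B : ℕ → ℝ → M) (β : ℝ → ℝ → M) : Prop where
  per : ∀ t, 0 ≤ t → Function.Periodic (β t) 1
  char : ∀ t, 0 ≤ t → ∀ i : ℕ, ∀ u ∈ Icc (0:ℝ) 1,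
    β t ((arc B i t + u * ell B i t) / arc B n t) = G.geod (B i t) (B (i + 1) t) u

theorem per_nat {f : ℝ → M} (h : Function.Periodic f 1) (s : ℝ) (k : ℕ) : f (s + k) = f s := by
  have := h.nat_mul k s
  rwa [mul_one] at this

theorem per_int {f : ℝ → M} (h : Function.Periodic f 1) (s : ℝ) (k : ℤ) : f (s + k) = f s := by
  have := h.int_mul k s
  rwa [mul_one] at this

namespace Purs

variable {G : GeodesicStructure M} {n : ℕ} {B : ℕ → ℝ → M} {β : ℝ → ℝ → M}

theorem arc_mul (P : Purs G n B) (k : ℕ) (t : ℝ) : arc B (k * n) t = k * arc B n t := by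
  induction k with
  | zero => simp [arc]
  | succ k ih => rw [Nat.succ_mul, P.arc_per, ih]; push_cast; ring

theorem arcI_mul (P : Purs G n B) (k : ℕ) : arcI B (k * n) = k * arcI B n := by
  induction k with
  | zero => simp [arcI]
  | succ k ih => rw [Nat.succ_mul, P.arcI_per, ih]; push_cast; ring

theorem arcI_unbdd (P : Purs G n B) (x : ℝ) : ∃ N, x < arcI B N := by
  obtain ⟨k, hk⟩ := exists_nat_gt (x / arcI B n)
  rw [div_lt_iff₀ P.arcI_pos] at hk
  exact ⟨k * n, by rwa [P.arcI_mul]⟩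

theorem locate (P : Purs G n B) {t : ℝ} (ht : 0 ≤ t) {x : ℝ} (hx : 0 ≤ x) :
    ∃ i : ℕ, ∃ u ∈ Icc (0:ℝ) 1, x = arc B i t + u * ell B i t := by
  obtain ⟨k, hk⟩ := exists_nat_gt (x / arc B n t)
  rw [div_lt_iff₀ (P.arc_pos ht), ← P.arc_mul] at hk
  obtain ⟨i, h1, h2⟩ := nat_switch (fun i => x < arc B i t) (by simpa [arc] using hx) ⟨_, hk⟩
  push Not at h1
  rw [arc_succ] at h2
  have hl : 0 < ell B i t := by linarith
  refine ⟨i, (x - arc B i t) / ell B i t, ⟨div_nonneg (by linarith) hl.le,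
    div_le_one_of_le₀ (by linarith) hl.le⟩, ?_⟩
  rw [div_mul_cancel₀ _ hl.ne']
  ring

theorem lip_aux (P : Purs G n B) (hβ : Loops G n B β) {t : ℝ} (ht : 0 ≤ t) {s s' : ℝ}
    (hs : 0 ≤ s) (hss : s ≤ s') : dist (β t s) (β t s') ≤ arc B n t * (s' - s) := by
  have hp := P.arc_pos ht
  obtain ⟨i, u, hu, hi⟩ := P.locate ht (show 0 ≤ s * arc B n t by positivity)
  obtain ⟨j, v, hv, hj⟩ := P.locate ht (show 0 ≤ s' * arc B n t by
    have := hs.trans hss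
    positivity)
  have hle : s * arc B n t ≤ s' * arc B n t := by gcongr
  have es : s = (arc B i t + u * ell B i t) / arc B n t := by
    rw [← hi, mul_div_cancel_right₀ _ hp.ne']
  have es' : s' = (arc B j t + v * ell B j t) / arc B n t := by
    rw [← hj, mul_div_cancel_right₀ _ hp.ne']
  have e1 : β t s = G.geod (B i t) (B (i + 1) t) u := by rw [es]; exact hβ.char t ht i u hu
  have e2 : β t s' = G.geod (B j t) (B (j + 1) t) v := by rw [es']; exact hβ.char t ht j v hv
  have e3 : arc B n t * (s' - s) = (arc B j t + v * ell B j t) - (arc B i t + u * ell B i t) := by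
    rw [← hi, ← hj]; ring
  rw [e1, e2, e3]
  rcases lt_trichotomy i j with h | h | h
  · have d1 := P.dist_geod_right ht i hu
    have d2 := P.dist_geod_left ht j hv
    have d3 := arc_dist B (show i + 1 ≤ j from h) t
    rw [arc_succ] at d3
    have := dist_triangle4_right (G.geod (B i t) (B (i + 1) t) u) (G.geod (B j t) (B (j + 1) t) v)
      (B (i + 1) t) (B j t)
    have := dist_triangle4 (G.geod (B i t) (B (i + 1) t) u) (B (i + 1) t) (B j t)
      (G.geod (B j t) (B (j + 1) t) v)
    rw [dist_comm (B j t)] at this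
    linarith
  · subst h
    rw [G.geod_dist _ _ (lt_injAt G _ (P.sep ht i)) u hu v hv]
    rw [hi, hj] at hle
    have : |u - v| * ell B i t = |(v * ell B i t) - u * ell B i t| := by
      rw [← sub_mul, abs_mul, abs_sub_comm, abs_of_nonneg (a := ell B i t) dist_nonneg]
    simp only [ell] at this hle ⊢
    rw [this, abs_of_nonneg (by linarith)]
    linarith
  · have d1 := P.dist_geod_left ht i hu
    have d2 := P.dist_geod_right ht j hv
    have d3 := arc_dist B (show j + 1 ≤ i from h) t
    rw [arc_succ] at d3
    have := dist_triangle4 (G.geod (B j t) (B (j + 1) t) v) (B (j + 1) t) (B i t)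
      (G.geod (B i t) (B (i + 1) t) u)
    rw [dist_comm (B i t)] at this
    have d4 := arc_mono B t (show j + 1 ≤ i from h)
    simp only at d4
    rw [arc_succ] at d4
    have f1 : v * ell B j t ≤ 1 * ell B j t := mul_le_mul_of_nonneg_right hv.2 dist_nonneg
    have f2 : 0 ≤ u * ell B i t := mul_nonneg hu.1 dist_nonneg
    have f3 : (1 - v) * ell B j t = ell B j t - v * ell B j t := by ring
    rw [dist_comm]
    have d5 : dist (B (j + 1) t) (B i t) ≤ 0 := by linarith
    linarith

theorem lip (P : Purs G n B) (hβ : Loops G n B β) {t : ℝ} (ht : 0 ≤ t) (s s' : ℝ) :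
    dist (β t s) (β t s') ≤ arc B n t * |s - s'| := by
  wlog h : s ≤ s' generalizing s s'
  · rw [dist_comm, abs_sub_comm]
    exact this s' s (le_of_not_ge h)
  obtain ⟨k, hk⟩ := exists_nat_ge (-s)
  have := P.lip_aux hβ ht (s := s + k) (s' := s' + k) (by linarith) (by linarith)
  rw [per_nat (hβ.per t ht), per_nat (hβ.per t ht)] at this
  rw [abs_sub_comm, abs_of_nonneg (by linarith)]
  refine this.trans (le_of_eq (by ring))

/-- A limit loop along an ultrafilter. -/
structure IsLim (U : Ultrafilter ℝ) (β : ℝ → ℝ → M) (α : ℝ → M) : Prop where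
  le : (U : Filter ℝ) ≤ atTop
  tends : ∀ s, Tendsto (fun t => β t s) U (𝓝 (α s))

theorem exists_lim [CompactSpace M] (β : ℝ → ℝ → M) : ∃ U α, IsLim U β α := by
  refine ⟨Ultrafilter.of atTop, fun s => ((Ultrafilter.of atTop).map (fun t => β t s)).lim,
    Ultrafilter.of_le _, fun s => ?_⟩
  exact Ultrafilter.le_nhds_lim ((Ultrafilter.of atTop).map (fun t => β t s))

variable {U : Ultrafilter ℝ} {α : ℝ → M}

theorem lim_per (hβ : Loops G n B β) (hα : IsLim U β α) : Function.Periodic α 1 := fun s => by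
  refine tendsto_nhds_unique (hα.tends (s + 1)) ((hα.tends s).congr' ?_)
  filter_upwards [hα.le (eventually_ge_atTop 0)] with t ht
  exact (hβ.per t ht s).symm

theorem lim_lip (P : Purs G n B) (hβ : Loops G n B β) (hα : IsLim U β α) (s s' : ℝ) :
    dist (α s) (α s') ≤ arcI B n * |s - s'| := by
  refine le_of_tendsto_of_tendsto ((hα.tends s).dist (hα.tends s'))
    (((P.tendsto_arc n).mono_left hα.le).mul_const _) ?_
  filter_upwards [hα.le (eventually_ge_atTop 0)] with t ht
  exact P.lip hβ ht s s'

theorem lim_char (P : Purs G n B) (hβ : Loops G n B β) (hα : IsLim U β α) (i : ℕ) {u : ℝ}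
    (hu : u ∈ Icc (0:ℝ) 1) :
    Tendsto (fun t => G.geod (B i t) (B (i + 1) t) u) U
      (𝓝 (α ((arcI B i + u * ellI B i) / arcI B n))) := by
  have hL := P.arcI_pos
  set s0 := (arcI B i + u * ellI B i) / arcI B n with hs0
  have h1 : Tendsto (fun t => arc B n t * |s0 - (arc B i t + u * ell B i t) / arc B n t|) U
      (𝓝 (arcI B n * |s0 - s0|)) := by
    refine Tendsto.mono_left ?_ hα.le
    exact (P.tendsto_arc n).mul ((tendsto_const_nhds.sub
      (((P.tendsto_arc i).add ((P.tendsto_ell i).const_mul u)).div (P.tendsto_arc n) hL.ne')).abs)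
  rw [sub_self, abs_zero, mul_zero] at h1
  refine (tendsto_iff_of_dist ?_).1 (hα.tends s0)
  refine squeeze_zero' (Eventually.of_forall fun _ => dist_nonneg) ?_ h1
  filter_upwards [hα.le (eventually_ge_atTop 0)] with t ht
  rw [← hβ.char t ht i u hu]
  exact P.lip hβ ht _ _

theorem lim_bug (P : Purs G n B) (hβ : Loops G n B β) (hα : IsLim U β α) (i : ℕ) :
    Tendsto (fun t => B i t) U (𝓝 (α (arcI B i / arcI B n))) := by
  have h := P.lim_char hβ hα i (u := 0) (by simp)
  rw [zero_mul, add_zero] at h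
  refine h.congr' ?_
  filter_upwards [hα.le (eventually_ge_atTop 0)] with t ht
  exact G.geod_zero _ _ (lt_injAt G _ (P.sep ht i))

end Purs


theorem iso_of_ends {α : ℝ → M} {L : ℝ} (hlip : ∀ s u, dist (α s) (α u) ≤ L * |s - u|)
    {a b : ℝ} (h : L * (b - a) ≤ dist (α a) (α b)) {s u : ℝ} (hs : s ∈ Icc a b)
    (hu : u ∈ Icc a b) : dist (α s) (α u) = L * |s - u| := by
  wlog hsu : s ≤ u generalizing s u
  · rw [dist_comm, abs_sub_comm]
    exact this hu hs (le_of_not_ge hsu)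
  apply le_antisymm (hlip s u)
  have h1 := hlip a s
  have h2 := hlip u b
  have h3 := dist_triangle4 (α a) (α s) (α u) (α b)
  rw [abs_sub_comm, abs_of_nonneg (by linarith [hs.1])] at h1
  rw [abs_sub_comm, abs_of_nonneg (by linarith [hu.2])] at h2
  rw [abs_sub_comm, abs_of_nonneg (by linarith)]
  linarith

theorem curve_geod (G : GeodesicStructure M) {α : ℝ → M} {L : ℝ} {a b : ℝ}
    (h : ∀ x ∈ uIcc a b, ∀ y ∈ uIcc a b, dist (α x) (α y) = L * |x - y|)
    (hL : L * |a - b| < G.inj) {u : ℝ} (hu : u ∈ Icc (0:ℝ) 1) :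
    G.geod (α a) (α b) u = α (a + u * (b - a)) := by
  have hab := h a left_mem_uIcc b right_mem_uIcc
  have hm : ∀ u ∈ Icc (0:ℝ) 1, a + u * (b - a) ∈ uIcc a b := by
    intro u hu
    rw [← segment_eq_uIcc]
    exact ⟨1 - u, u, by linarith [hu.2], hu.1, by ring, by simp only [smul_eq_mul]; ring⟩
  refine (G.geod_unique (α a) (α b) (lt_injAt G _ (by rw [hab]; exact hL))
    (fun u => α (a + u * (b - a))) (by simp) (by simp) ?_ u hu).symm
  intro s hs u hu
  rw [h _ (hm s hs) _ (hm u hu), hab]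
  have : a + s * (b - a) - (a + u * (b - a)) = (s - u) * (b - a) := by ring
  rw [this, abs_mul, abs_sub_comm b a]
  ring

theorem iso_inj (G : GeodesicStructure M) (hinj : 0 < G.inj) (hnp : NonposCurvedOn G Set.univ)
    {α : ℝ → M} {L : ℝ} (hL : 0 < L) (hlip : ∀ s u, dist (α s) (α u) ≤ L * |s - u|)
    {e : ℝ} (he : 0 < e) (hiso : ∀ s u : ℝ, |s - u| ≤ e → dist (α s) (α u) = L * |s - u|)
    {s u : ℝ} (hsu : L * |s - u| < G.inj) : dist (α s) (α u) = L * |s - u| := by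
  obtain ⟨d, hd0, hd1⟩ : ∃ d, 0 < d ∧ d < min (e / 2) (G.inj / (2 * L)) :=
    exists_between (lt_min (by positivity) (by positivity))
  rw [lt_min_iff] at hd1
  obtain ⟨hde, hdi⟩ := hd1
  rw [lt_div_iff₀ (by positivity)] at hdi
  have key : ∀ k : ℕ, ∀ s x : ℝ, 0 ≤ x → x ≤ (k + 2) * d → L * x < G.inj →
      L * x ≤ dist (α s) (α (s + x)) := by
    intro k
    induction k with
    | zero =>
      intro s x hx0 hx _
      have hx2 : |s - (s + x)| = x := by rw [sub_add_cancel_left, abs_neg, abs_of_nonneg hx0]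
      have := hiso s (s + x) (by rw [hx2]; push_cast at hx; linarith)
      rw [hx2] at this
      exact this.ge
    | succ k ih =>
      intro s x hx0 hx hxL
      rcases le_total x ((k + 2) * d) with h | h
      · exact ih s x hx0 h hxL
      have hx2d : 2 * d ≤ x := by
        refine le_trans ?_ h
        have : (0:ℝ) ≤ k := Nat.cast_nonneg k
        nlinarith
      push_cast at hx
      have i1 := ih s (x - d) (by linarith) (by linarith) (by nlinarith)
      have u1 := hlip s (s + (x - 2 * d))
      rw [sub_add_cancel_left, abs_neg, abs_of_nonneg (by linarith)] at u1
      have hseg : ∀ y ∈ uIcc (s + (x - 2 * d)) (s + x), ∀ z ∈ uIcc (s + (x - 2 * d)) (s + x),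
          dist (α y) (α z) = L * |y - z| := by
        intro y hy z hz
        rw [uIcc_of_le (by linarith)] at hy hz
        apply hiso
        rw [abs_le]
        constructor <;> linarith [hy.1, hy.2, hz.1, hz.2]
      have habs : |s + (x - 2 * d) - (s + x)| = 2 * d := by
        rw [show s + (x - 2 * d) - (s + x) = - (2 * d) by ring, abs_neg,
          abs_of_nonneg (by linarith)]
      have hl2 : L * |s + (x - 2 * d) - (s + x)| < G.inj := by rw [habs]; linarith
      have hg : ∀ u ∈ Icc (0:ℝ) 1, G.geod (α (s + (x - 2 * d))) (α (s + x)) u =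
          α (s + (x - 2 * d) + u * (s + x - (s + (x - 2 * d)))) := fun u hu =>
        curve_geod G hseg hl2 hu
      have c := cvx_pt G hinj hnp (α (s + (x - 2 * d))) (α (s + x)) (α s)
        (by rw [hseg _ left_mem_uIcc _ right_mem_uIcc]; exact hl2)
        (fun u hu => by
          rw [hg u hu]
          have := hlip (s + (x - 2 * d) + u * (s + x - (s + (x - 2 * d)))) s
          have e1 : s + (x - 2 * d) + u * (s + x - (s + (x - 2 * d))) - s
              = x - 2 * d + u * (2 * d) := by ring
          have h1 : u * (2 * d) ≤ 2 * d := by nlinarith [hu.2]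
          have h2 : 0 ≤ u * (2 * d) := mul_nonneg hu.1 (by linarith)
          rw [e1, abs_of_nonneg (by linarith)] at this
          nlinarith)
        (show (0:ℝ) ≤ 1/2 by norm_num) (show (1/2:ℝ) ≤ 1 by norm_num) one_pos le_rfl
      rw [hg _ (by norm_num), hg _ (by norm_num)] at c
      have e2 : s + (x - 2 * d) + 1 / 2 * (s + x - (s + (x - 2 * d))) = s + (x - d) := by ring
      have e3 : s + (x - 2 * d) + 1 * (s + x - (s + (x - 2 * d))) = s + x := by ring
      rw [e2, e3, dist_comm _ (α s), dist_comm _ (α s), dist_comm _ (α s)] at c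
      linarith
  wlog h : s ≤ u generalizing s u
  · rw [dist_comm, abs_sub_comm]
    exact this (by rwa [abs_sub_comm]) (le_of_not_ge h)
  apply le_antisymm (hlip s u)
  rw [abs_sub_comm, abs_of_nonneg (by linarith)] at hsu ⊢
  obtain ⟨k, hk⟩ := exists_nat_ge ((u - s) / d)
  rw [div_le_iff₀ hd0] at hk
  have := key k s (u - s) (by linarith) (by linarith) hsu
  rwa [add_sub_cancel] at this

namespace Purs

variable {G : GeodesicStructure M} {n : ℕ} {B : ℕ → ℝ → M} {β : ℝ → ℝ → M}
variable {U : Ultrafilter ℝ} {α : ℝ → M}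

theorem lim_local (P : Purs G n B) (hβ : Loops G n B β) (hα : IsLim U β α) {s : ℝ} (hs : 0 < s) :
    ∃ a b, a < s ∧ s < b ∧ arcI B n * (b - a) ≤ dist (α a) (α b) := by
  have hL := P.arcI_pos
  set L := arcI B n with hLdef
  have hx : 0 < s * L := by positivity
  obtain ⟨i, hi1, hi2⟩ := nat_switch (fun i => s * L ≤ arcI B i) (by simpa [arcI] using hx)
    ((P.arcI_unbdd (s * L)).imp fun _ h => h.le)
  obtain ⟨j, hj1, hj2⟩ := nat_switch (fun i => s * L < arcI B i) (by simpa [arcI] using hx.le)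
    (P.arcI_unbdd (s * L))
  push Not at hi1 hj1
  have hij : i < j + 1 := by
    by_contra h
    have := arcI_mono B (not_lt.1 h)
    linarith
  rcases eq_or_lt_of_le (Nat.lt_succ_iff.1 hij) with h | h
  · subst h
    refine ⟨arcI B i / L, arcI B (i + 1) / L, by rwa [div_lt_iff₀ hL], by rwa [lt_div_iff₀ hL], ?_⟩
    have h1 := (P.lim_bug hβ hα i).dist (P.lim_bug hβ hα (i + 1))
    have h2 := tendsto_nhds_unique h1 ((P.tendsto_ell i).mono_left hα.le)
    rw [h2, arcI_succ]
    apply le_of_eq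
    field_simp
    ring
  · have h3 := arcI_mono B (show i + 1 ≤ j from h)
    have ei : arcI B (i + 1) = s * L := le_antisymm (h3.trans hj1) hi2
    have ej : arcI B j = s * L := le_antisymm hj1 (hi2.trans h3)
    have he : 0 < ellI B i := by rw [arcI_succ] at ei; linarith
    have hf : 0 < ellI B j := by rw [arcI_succ] at hj2; linarith
    obtain ⟨κ, hκ0, hκi, hκ⟩ := P.bound
    have hip := P.injpos
    obtain ⟨μ, hμ0, hμ1, hμκ⟩ : ∃ μ : ℝ, 0 < μ ∧ μ ≤ 1 ∧ κ + μ * κ < G.inj := by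
      refine ⟨(G.inj - κ) / (G.inj + κ), div_pos (by linarith) (by linarith),
        div_le_one_of_le₀ (by linarith) (by linarith), ?_⟩
      have : (G.inj - κ) / (G.inj + κ) * κ < G.inj - κ := by
        rw [div_mul_eq_mul_div, div_lt_iff₀ (by linarith)]
        nlinarith
      linarith
    have hd : Tendsto (fun t => dist (B (i + 1) t) (B j t)) atTop (𝓝 0) := by
      have := (P.tendsto_arc j).sub (P.tendsto_arc (i + 1))
      rw [ei, ej, sub_self] at this
      exact squeeze_zero (fun _ => dist_nonneg) (fun t => arc_dist B h t) this
    have h1 := P.lim_char hβ hα i (u := 1 - μ) ⟨by linarith, by linarith⟩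
    have h2 := P.lim_char hβ hα j (u := 1) (by simp)
    have key : μ * ellI B i + 1 * ellI B j ≤ _ := le_of_forall_pos_le_add fun ε hε => by
      have := ge_of_tendsto (h1.dist h2) (hα.le (P.corner hκ i j he hf hd hμ0 hμ1 one_pos
        le_rfl hμκ hε))
      exact sub_le_iff_le_add.1 this
    refine ⟨(arcI B i + (1 - μ) * ellI B i) / arcI B n, (arcI B j + 1 * ellI B j) / arcI B n, ?_, ?_,
      le_trans (le_of_eq ?_) key⟩
    · rw [div_lt_iff₀ hL]
      rw [arcI_succ] at ei
      have : 0 < μ * ellI B i := by positivity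
      linarith
    · rw [lt_div_iff₀ hL]
      linarith
    · rw [arcI_succ] at ei
      rw [← hLdef]
      field_simp
      linarith

theorem lim_iso (P : Purs G n B) (hβ : Loops G n B β) (hα : IsLim U β α) :
    ∃ e > (0:ℝ), ∀ s u : ℝ, |s - u| ≤ e → dist (α s) (α u) = arcI B n * |s - u| := by
  have hper := lim_per hβ hα
  have hlip := P.lim_lip hβ hα
  have h1 : ∀ s : ℝ, ∃ e > 0, ∀ x ∈ ball s e, ∀ y ∈ ball s e,
      dist (α x) (α y) = arcI B n * |x - y| := by
    intro s
    obtain ⟨k, hk⟩ := exists_nat_gt (-s)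
    obtain ⟨a, b, ha, hb, hab⟩ := P.lim_local hβ hα (show 0 < s + k by linarith)
    refine ⟨min (s + k - a) (b - (s + k)), lt_min (by linarith) (by linarith), ?_⟩
    intro x hx y hy
    rw [mem_ball, Real.dist_eq, abs_lt, lt_min_iff, neg_lt, lt_min_iff] at hx hy
    rw [← per_nat hper x k, ← per_nat hper y k,
      iso_of_ends hlip hab ⟨by linarith, by linarith⟩ ⟨by linarith, by linarith⟩]
    congr 2
    ring
  choose e he hiso using h1
  obtain ⟨δ, hδ, H⟩ := lebesgue_number_lemma_of_metric (isCompact_Icc (a := (0:ℝ)) (b := 1))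
    (c := fun s => ball s (e s)) (fun s => isOpen_ball)
    (fun s _ => mem_iUnion.2 ⟨s, mem_ball_self (he s)⟩)
  refine ⟨δ / 2, by positivity, fun s u hsu => ?_⟩
  have hf0 := Int.floor_le s
  have hf1 := (Int.lt_floor_add_one s).le
  obtain ⟨i, hi⟩ := H (s + ((-⌊s⌋ : ℤ) : ℝ)) (by
    push_cast
    exact ⟨by linarith, by linarith⟩)
  have := hiso i (s + ((-⌊s⌋ : ℤ) : ℝ)) (hi (mem_ball_self hδ)) (u + ((-⌊s⌋ : ℤ) : ℝ))
    (hi (by rw [mem_ball, dist_add_right, Real.dist_eq, abs_sub_comm]; linarith))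
  rw [per_int hper, per_int hper, add_sub_add_right_eq_sub] at this
  exact this

end Purs


/-- A globally controlled closed geodesic. -/
structure CG (G : GeodesicStructure M) (α : ℝ → M) (L : ℝ) : Prop where
  per : Function.Periodic α 1
  pos : 0 < L
  lip : ∀ s u, dist (α s) (α u) ≤ L * |s - u|
  iso : ∀ s u, L * |s - u| < G.inj → dist (α s) (α u) = L * |s - u|
  geod : ∀ a b u, L * |a - b| < G.inj → u ∈ Icc (0:ℝ) 1 →
    G.geod (α a) (α b) u = α (a + u * (b - a))

/-- Follow-up index after all merges have taken place. -/
structure Foll (B : ℕ → ℝ → M) (n : ℕ) (T : ℝ) (J : ℕ → ℕ) : Prop where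
  nonneg : 0 ≤ T
  un : ∀ i t, T ≤ t → B (J i) t ≠ B (J i + 1) t
  eq : ∀ i t, T ≤ t → B i t = B (J i) t
  idem : ∀ i, J (J i) = J i
  per : ∀ i, J (i + n) = J i + n
  arc : ∀ i, arcI B (J i) = arcI B i

/-- Shadowing invariant. -/
structure Inv (B : ℕ → ℝ → M) (n : ℕ) (J : ℕ → ℕ) (α : ℝ → M) (L K E t : ℝ) (θ : ℕ → ℝ) : Prop where
  per : ∀ i, θ (i + n) = θ i + 1
  foll : ∀ i, θ (J i) = θ i
  gap : ∀ i, L * |θ i - θ (i + 1)| ≤ K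
  near : ∀ i, dist (B i t) (α (θ i)) ≤ E

namespace Purs

variable {G : GeodesicStructure M} {n : ℕ} {B : ℕ → ℝ → M} {β : ℝ → ℝ → M}
variable {U : Ultrafilter ℝ} {α : ℝ → M} {L : ℝ} {J : ℕ → ℕ} {T : ℝ}

theorem exists_foll (P : Purs G n B) : ∃ T J, Foll B n T J := by
  have h1 : ∀ i, ∃ T, 0 ≤ T ∧ ∀ t, T ≤ t → B i t = B (i + 1) t → B i T = B (i + 1) T := by
    intro i
    by_cases h : ∃ t, 0 ≤ t ∧ B i t = B (i + 1) t
    · obtain ⟨t, ht, e⟩ := h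
      exact ⟨t, ht, fun _ _ _ => e⟩
    · push Not at h
      exact ⟨0, le_rfl, fun t ht e => absurd e (h t ht)⟩
  choose T hT0 hT using h1
  set T0 := ∑ k ∈ Finset.range n, T k with hT0def
  have hT00 : 0 ≤ T0 := Finset.sum_nonneg fun k _ => hT0 k
  have hmg : ∀ i t, T0 ≤ t → B i t = B (i + 1) t → B i T0 = B (i + 1) T0 := by
    intro i t ht e
    obtain ⟨r, hr, e1, e2⟩ := P.red i
    rw [e1, e2] at e ⊢
    have hle : T r ≤ T0 := Finset.single_le_sum (f := T) (fun k _ => hT0 k) (Finset.mem_range.2 hr)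
    exact P.merge r (T r) T0 (hT0 r) hle (hT r t (hle.trans ht) e)
  have hf := fun i => P.follow hT00 i
  choose J hJ1 hJ2 hJ3 hJ4 using hf
  have uniq : ∀ i j, i ≤ j → B j T0 ≠ B (j + 1) T0 →
      (∀ k, i ≤ k → k < j → B k T0 = B (k + 1) T0) → J i = j := by
    intro i j hij hj hk
    rcases lt_trichotomy (J i) j with h | h | h
    · exact absurd (hk _ (hJ1 i) h) (hJ2 i)
    · exact h
    · exact absurd (hJ3 i j hij h) hj
  refine ⟨T0, J, hT00, fun i t ht e => hJ2 i (hmg _ t ht e), fun i t ht => hJ4 i t ht, ?_, ?_, ?_⟩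
  · intro i
    exact uniq _ _ le_rfl (hJ2 i) fun k h1 h2 => by omega
  · intro i
    refine uniq _ _ (by have := hJ1 i; omega) ?_ ?_
    · rw [add_right_comm, P.per, P.per]
      exact hJ2 i
    · intro k h1 h2
      obtain ⟨m, rfl⟩ : ∃ m, k = m + n := ⟨k - n, by omega⟩
      rw [add_right_comm, P.per, P.per]
      exact hJ3 i m (by omega) (by omega)
  · intro i
    have : ∀ j, i ≤ j → (∀ k, i ≤ k → k < j → B k T0 = B (k + 1) T0) → arcI B j = arcI B i := by
      intro j hij
      induction j, hij using Nat.le_induction with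
      | base => intro _; rfl
      | succ k hk ih =>
        intro h
        rw [arcI_succ, ih fun m h1 h2 => h m h1 (by omega)]
        have h1 := ellI_le B k hT00
        have h2 := ellI_nonneg B k
        have h3 : ell B k T0 = 0 := dist_eq_zero.2 (h k hk (by omega))
        linarith
    exact this _ (hJ1 i) (hJ3 i)

theorem ev_all (P : Purs G n B) {x : ℝ} (hx : 0 ≤ x) {δ y : ℝ} (hδ : 0 < δ) (hy : 0 < y) :
    ∀ᶠ h in 𝓝[>] (0:ℝ), ∀ j, B j x ≠ B (j + 1) x →
      dist (B j (x + h)) (G.geod (B j x) (B (j + 1) x) (h / ell B j x)) ≤ δ * h ∧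
      h < ell B j x ∧ h < y * ell B j x := by
  have H : ∀ r ∈ Finset.range n, ∀ᶠ h in 𝓝[>] (0:ℝ), B r x ≠ B (r + 1) x →
      dist (B r (x + h)) (G.geod (B r x) (B (r + 1) x) (h / ell B r x)) ≤ δ * h ∧
      h < ell B r x ∧ h < y * ell B r x := by
    intro r _
    by_cases hr : B r x = B (r + 1) x
    · exact Eventually.of_forall fun h h' => absurd hr h'
    have hd : 0 < ell B r x := dist_pos.2 hr
    filter_upwards [P.chase r x hx hr (P.sep hx r) δ hδ, ev_small hd,
      ev_small (mul_pos hy hd)] with h h1 h2 h3 _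
    exact ⟨h1, h2.2, h3.2⟩
  filter_upwards [(Filter.eventually_all_finset _).2 H] with h hh j hj
  obtain ⟨r, hr, e1, e2⟩ := P.red j
  simp only [ell, e1, e2] at hj ⊢
  exact hh r (Finset.mem_range.2 hr) hj

theorem inv_step (P : Purs G n B) (hJ : Foll B n T J) (hα : CG G α L) {κ ε E x δ : ℝ}
    (hκ : ∀ i t, 0 ≤ t → dist (B i t) (B (i + 1) t) ≤ κ) (hκ0 : 0 ≤ κ) (hε : 0 < ε)
    (hκε : κ + 6 * ε < G.inj) (hx : T ≤ x) (hE : E ≤ 2 * ε) (hδ : 0 < δ) {θ : ℕ → ℝ}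
    (hθ : Inv B n J α L (κ + 4 * ε) E x θ) :
    ∀ᶠ h in 𝓝[>] (0:ℝ), E + δ * h ≤ 2 * ε →
      ∃ θ', Inv B n J α L (κ + 4 * ε) (E + δ * h) (x + h) θ' := by
  have hx0 := hJ.nonneg.trans hx
  have hL := hα.pos
  set K := κ + 4 * ε with hK
  have hK0 : 0 < K := by linarith
  have hE0 : 0 ≤ E := dist_nonneg.trans (hθ.near 0)
  have hKE : K + E < G.inj := by linarith
  filter_upwards [P.ev_all hx0 hδ (show 0 < ε / (2 * K) by positivity), ev_small one_pos]
    with h hh h0 hle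
  have hpos := h0.1
  set r : ℕ → ℝ := fun j => (θ (j + 1) - θ j) / ell B j x with hr
  have hrb : ∀ i, L * |h * r (J i)| ≤ ε / 2 := by
    intro i
    have hu := hJ.un i x hx
    have hd : 0 < ell B (J i) x := dist_pos.2 hu
    have h3 := (hh (J i) hu).2.2
    have g := hθ.gap (J i)
    rw [abs_mul, abs_of_pos hpos, hr]
    simp only
    rw [abs_div, abs_of_pos hd, abs_sub_comm]
    have e1 : L * (h * (|θ (J i) - θ (J i + 1)| / ell B (J i) x)) =
        h / ell B (J i) x * (L * |θ (J i) - θ (J i + 1)|) := by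
      field_simp
    rw [e1]
    calc h / ell B (J i) x * (L * |θ (J i) - θ (J i + 1)|) ≤ ε / (2 * K) * K := by
          apply mul_le_mul _ g (by positivity) (by positivity)
          rw [div_le_iff₀ hd]
          exact h3.le
      _ = ε / 2 := by field_simp
  have near : ∀ i, dist (B i (x + h)) (α (θ i + h * r (J i))) ≤ E + δ * h := by
    intro i
    have hu := hJ.un i x hx
    have hd : 0 < ell B (J i) x := dist_pos.2 hu
    obtain ⟨h1, h2, _⟩ := hh (J i) hu
    rw [hJ.eq i (x + h) (by linarith), ← hθ.foll i]
    have hmem : h / ell B (J i) x ∈ Icc (0:ℝ) 1 :=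
      ⟨by positivity, div_le_one_of_le₀ h2.le hd.le⟩
    have g := hθ.gap (J i)
    have e1 : α (θ (J i) + h * r (J i)) =
        G.geod (α (θ (J i))) (α (θ (J i + 1))) (h / ell B (J i) x) := by
      rw [hα.geod _ _ _ (by linarith) hmem]
      congr 1
      rw [hr]
      simp only
      ring
    have c := cvx_two G P.np (B (J i) x) (B (J i + 1) x) (α (θ (J i))) (α (θ (J i + 1)))
      (k := K) (m := E) ((hκ _ _ hx0).trans (by linarith))
      (by rw [hα.iso _ _ (by linarith)]; exact g) (hθ.near _) (hθ.near _) hKE hmem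
    rw [e1]
    have := dist_triangle (B (J i) (x + h))
      (G.geod (B (J i) x) (B (J i + 1) x) (h / ell B (J i) x))
      (G.geod (α (θ (J i))) (α (θ (J i + 1))) (h / ell B (J i) x))
    linarith
  refine ⟨fun i => θ i + h * r (J i), ?_, ?_, ?_, near⟩
  · intro i
    rw [hJ.per, hθ.per]
    have : r (J i + n) = r (J i) := by
      simp only [hr]
      rw [add_right_comm, hθ.per, hθ.per, P.ell_per]
      ring
    rw [this]
    ring
  · intro i
    simp only [hJ.idem, hθ.foll]
  · intro i
    have b1 : |θ i + h * r (J i) - (θ (i + 1) + h * r (J (i + 1)))| ≤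
        |θ i - θ (i + 1)| + |h * r (J i)| + |h * r (J (i + 1))| := by
      have e : θ i + h * r (J i) - (θ (i + 1) + h * r (J (i + 1))) =
        (θ i - θ (i + 1)) + h * r (J i) - h * r (J (i + 1)) := by ring
      rw [e]
      exact (abs_sub _ _).trans (add_le_add_left (abs_add_le _ _) _)
    have b2 := mul_le_mul_of_nonneg_left b1 hL.le
    have g := hθ.gap i
    have r1 := hrb i
    have r2 := hrb (i + 1)
    have lt : L * |θ i + h * r (J i) - (θ (i + 1) + h * r (J (i + 1)))| < G.inj := by linarith
    rw [← hα.iso _ _ lt]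
    have n1 := near i
    have n2 := near (i + 1)
    have k1 := hκ i (x + h) (by linarith)
    have := dist_triangle4 (α (θ i + h * r (J i))) (B i (x + h)) (B (i + 1) (x + h))
      (α (θ (i + 1) + h * r (J (i + 1))))
    rw [dist_comm (α (θ i + h * r (J i))) (B i (x + h))] at this
    linarith

theorem inv_norm (hα : CG G α L) {K E t : ℝ} {θ : ℕ → ℝ} (hθ : Inv B n J α L K E t θ) :
    ∃ θ', θ' 0 ∈ Icc (0:ℝ) 1 ∧ Inv B n J α L K E t θ' := by
  refine ⟨fun i => θ i + ((-⌊θ 0⌋ : ℤ) : ℝ), ?_, ?_, ?_, ?_, ?_⟩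
  · have hf0 := Int.floor_le (θ 0)
    have hf1 := (Int.lt_floor_add_one (θ 0)).le
    push_cast
    exact ⟨by linarith, by linarith⟩
  · intro i
    simp only [hθ.per]; ring
  · intro i
    simp only [hθ.foll]
  · intro i
    simp only [add_sub_add_right_eq_sub]
    exact hθ.gap i
  · intro i
    rw [per_int hα.per]
    exact hθ.near i

theorem inv_bdd (hα : CG G α L) {K E t : ℝ} {θ : ℕ → ℝ} (hθ : Inv B n J α L K E t θ)
    (h0 : θ 0 ∈ Icc (0:ℝ) 1) (i : ℕ) : θ i ∈ Icc (-(i * (K / L))) (1 + i * (K / L)) := by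
  induction i with
  | zero => simpa using h0
  | succ i ih =>
    have g := hθ.gap i
    rw [← le_div_iff₀' hα.pos, abs_le] at g
    push_cast
    constructor <;> nlinarith [ih.1, ih.2, g.1, g.2]

theorem inv_closed (P : Purs G n B) (hα : CG G α L) {K t1 T' : ℝ} (ht1 : 0 ≤ t1) (E : ℝ → ℝ)
    (hE : Continuous E) :
    IsClosed ({t | ∃ θ : ℕ → ℝ, θ 0 ∈ Icc (0:ℝ) 1 ∧ Inv B n J α L K (E t) t θ} ∩ Icc t1 T') := by
  rw [isClosed_iff_ultrafilter]
  intro x u hux hs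
  have hI : ∀ᶠ t in (u : Filter ℝ), t ∈ Icc t1 T' := mem_of_superset hs inter_subset_right
  have hx : x ∈ Icc t1 T' := isClosed_Icc.mem_of_tendsto (f := id) hux hI
  refine ⟨?_, hx⟩
  have hex : ∀ t : ℝ, ∃ θ : ℕ → ℝ, t ∈ {t | ∃ θ : ℕ → ℝ, θ 0 ∈ Icc (0:ℝ) 1 ∧
      Inv B n J α L K (E t) t θ} → θ 0 ∈ Icc (0:ℝ) 1 ∧ Inv B n J α L K (E t) t θ := by
    intro t
    by_cases h : ∃ θ : ℕ → ℝ, θ 0 ∈ Icc (0:ℝ) 1 ∧ Inv B n J α L K (E t) t θ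
    · obtain ⟨θ, h⟩ := h
      exact ⟨θ, fun _ => h⟩
    · exact ⟨fun _ => 0, fun h' => absurd h' h⟩
  choose Θ hΘ using hex
  have hev : ∀ᶠ t in (u : Filter ℝ), Θ t 0 ∈ Icc (0:ℝ) 1 ∧ Inv B n J α L K (E t) t (Θ t) := by
    filter_upwards [hs] with t ht using hΘ t ht.1
  have hlim : ∀ i, ∃ y, Tendsto (fun t => Θ t i) u (𝓝 y) := by
    intro i
    have hc : IsCompact (Icc (-(i * (K / L))) (1 + i * (K / L))) := isCompact_Icc
    obtain ⟨y, _, hy⟩ := hc.ultrafilter_le_nhds' (u.map fun t => Θ t i) (by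
      rw [Ultrafilter.mem_map]
      exact hev.mono fun t ht => inv_bdd hα ht.2 ht.1 i)
    exact ⟨y, hy⟩
  choose θ hθ using hlim
  have hcont : Continuous α := by
    have : LipschitzWith ⟨L, hα.pos.le⟩ α := LipschitzWith.of_dist_le_mul fun s u => by
      rw [Real.dist_eq]; exact hα.lip s u
    exact this.continuous
  refine ⟨θ, isClosed_Icc.mem_of_tendsto (hθ 0) (hev.mono fun t h => h.1), ?_, ?_, ?_, ?_⟩
  · intro i
    exact tendsto_nhds_unique_of_eventuallyEq (hθ (i + n)) ((hθ i).add_const 1)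
      (hev.mono fun t h => h.2.per i)
  · intro i
    exact tendsto_nhds_unique_of_eventuallyEq (hθ (J i)) (hθ i) (hev.mono fun t h => h.2.foll i)
  · intro i
    exact le_of_tendsto ((((hθ i).sub (hθ (i + 1))).abs).const_mul L)
      (hev.mono fun t h => h.2.gap i)
  · intro i
    have hB : Tendsto (B i) u (𝓝 (B i x)) := by
      have := P.cont i x (ht1.trans hx.1)
      refine this.mono_left ?_
      rw [nhdsWithin]
      refine le_inf hux ?_
      rw [le_principal_iff]
      exact mem_of_superset hI fun t ht => ht1.trans ht.1
    exact le_of_tendsto_of_tendsto (hB.dist ((hcont.tendsto _).comp (hθ i)))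
      ((hE.tendsto x).mono_left hux) (hev.mono fun t h => h.2.near i)

theorem inv_all (P : Purs G n B) (hJ : Foll B n T J) (hα : CG G α L) {κ ε t1 : ℝ}
    (hκ : ∀ i t, 0 ≤ t → dist (B i t) (B (i + 1) t) ≤ κ) (hκ0 : 0 ≤ κ) (hε : 0 < ε)
    (hκε : κ + 6 * ε < G.inj) (ht1 : T ≤ t1) {θ : ℕ → ℝ}
    (hθ : Inv B n J α L (κ + 4 * ε) ε t1 θ) {t : ℝ} (ht : t1 ≤ t) :
    ∃ θ', Inv B n J α L (κ + 4 * ε) (2 * ε) t θ' := by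
  set δ := ε / (t - t1 + 1) with hδ
  have hδ0 : 0 < δ := div_pos hε (by linarith)
  have hδ1 : ∀ x, x ≤ t → ε + δ * (x - t1) ≤ 2 * ε := by
    intro x hx
    have h1 : δ * (t - t1 + 1) = ε := by rw [hδ]; exact div_mul_cancel₀ _ (by linarith)
    nlinarith
  have key : Icc t1 t ⊆ {x | ∃ θ : ℕ → ℝ, θ 0 ∈ Icc (0:ℝ) 1 ∧
      Inv B n J α L (κ + 4 * ε) (ε + δ * (x - t1)) x θ} := by
    apply IsClosed.Icc_subset_of_forall_exists_gt
    · exact P.inv_closed hα (hJ.nonneg.trans ht1) (fun x => ε + δ * (x - t1)) (by fun_prop)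
    · simp only [mem_ofPred_eq, sub_self, mul_zero, add_zero]
      exact inv_norm hα hθ
    · rintro x ⟨⟨θ, h0, hx⟩, hxt⟩ y hy
      have st := P.inv_step hJ hα hκ hκ0 hε hκε (ht1.trans hxt.1) (hδ1 x hxt.2.le) hδ0 hx
      obtain ⟨h, h1, h2, h3⟩ := (st.and ((ev_small (sub_pos.2 hxt.2)).and
        (ev_small (sub_pos.2 hy)))).exists
      have e : ε + δ * (x - t1) + δ * h = ε + δ * (x + h - t1) := by ring
      rw [e] at h1
      obtain ⟨θ', hθ'⟩ := h1 (hδ1 _ (by linarith))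
      exact ⟨x + h, inv_norm hα hθ', by linarith, by linarith⟩
  obtain ⟨θ', _, h⟩ := key ⟨ht, le_rfl⟩
  have hle := hδ1 t le_rfl
  exact ⟨θ', h.per, h.foll, h.gap, fun i => (h.near i).trans hle⟩

theorem inv_close (P : Purs G n B) (hβ : Loops G n B β) (hα : CG G α (arcI B n)) {κ ε t : ℝ}
    (hκ : ∀ i t, 0 ≤ t → dist (B i t) (B (i + 1) t) ≤ κ) (hε : 0 < ε)
    (hκε : κ + 6 * ε < G.inj) (ht : 0 ≤ t) {θ : ℕ → ℝ}
    (hθ : Inv B n J α (arcI B n) (κ + 4 * ε) (2 * ε) t θ) (s : ℝ) :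
    dist (β t s) (α (s + θ 0)) ≤ 2 * ε + 2 * (arc B n t - arcI B n) + 4 * n * ε := by
  wlog hs : s ∈ Ico (0:ℝ) 1 generalizing s
  · have h := this (s + ((-⌊s⌋ : ℤ) : ℝ)) (by
      have hf0 := Int.floor_le s
      have hf1 := Int.lt_floor_add_one s
      push_cast
      exact ⟨by linarith, by linarith⟩)
    rwa [per_int (hβ.per t ht), add_right_comm, per_int hα.per] at h
  have hLpos := P.arcI_pos
  set L := arcI B n with hL
  have hA := P.arc_pos ht
  have hLA : L ≤ arc B n t := arcI_le_arc B n ht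
  obtain ⟨i, u, hu, hi⟩ := P.locate ht (show 0 ≤ s * arc B n t from mul_nonneg hs.1 hA.le)
  have hin : i < n := by
    by_contra h
    have h1 := arc_mono B t (not_lt.1 h)
    have h2 : 0 ≤ u * ell B i t := mul_nonneg hu.1 dist_nonneg
    have h3 : s * arc B n t < 1 * arc B n t := mul_lt_mul_of_pos_right hs.2 hA
    simp only at h1
    linarith
  have es : s = (arc B i t + u * ell B i t) / arc B n t := by
    rw [← hi, mul_div_cancel_right₀ _ hA.ne']
  have e1 : β t s = G.geod (B i t) (B (i + 1) t) u := by
    conv_lhs => rw [es]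
    exact hβ.char t ht i u hu
  have glt : ∀ k, L * |θ k - θ (k + 1)| < G.inj := fun k => by linarith [hθ.gap k]
  have e2 : α (θ i + u * (θ (i + 1) - θ i)) = G.geod (α (θ i)) (α (θ (i + 1))) u :=
    (hα.geod _ _ _ (glt i) hu).symm
  have c := cvx_two G P.np (B i t) (B (i + 1) t) (α (θ i)) (α (θ (i + 1)))
    (k := κ + 4 * ε) (m := 2 * ε) ((hκ _ _ ht).trans (by linarith))
    (by rw [hα.iso _ _ (glt i)]; exact hθ.gap i) (hθ.near _) (hθ.near _) (by linarith) hu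
  rw [← e1, ← e2] at c
  have inc : ∀ k, L * (θ (k + 1) - θ k) ≤ ell B k t + 4 * ε := by
    intro k
    have h1 := hα.iso _ _ (glt k)
    have h2 := dist_triangle4 (α (θ k)) (B k t) (B (k + 1) t) (α (θ (k + 1)))
    have h3 := hθ.near k
    have h4 := hθ.near (k + 1)
    rw [dist_comm (α (θ k)) (B k t)] at h2
    have h5 : L * (θ (k + 1) - θ k) ≤ L * |θ k - θ (k + 1)| := by
      rw [abs_sub_comm]
      exact mul_le_mul_of_nonneg_left (le_abs_self _) hLpos.le
    simp only [ell]
    linarith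
  have incs : ∀ a b : ℕ, a ≤ b →
      L * (θ b - θ a) ≤ arc B b t - arc B a t + 4 * ε * ((b:ℝ) - a) := by
    intro a b hab
    induction b, hab using Nat.le_induction with
    | base => simp
    | succ k hk ih =>
      rw [arc_succ]
      push_cast
      have := inc k
      linarith
  have i0 := incs 0 i (Nat.zero_le _)
  have i1 := incs (i + 1) n hin
  have hn : θ n = θ 0 + 1 := by have := hθ.per 0; rwa [zero_add] at this
  have a0 : arc B 0 t = 0 := by simp [arc]
  rw [a0] at i0
  rw [hn, arc_succ] at i1
  push_cast at i0 i1
  have ii := inc i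
  have iu := mul_le_mul_of_nonneg_left ii hu.1
  have iu' := mul_le_mul_of_nonneg_left ii (sub_nonneg.2 hu.2)
  have hin' : (i:ℝ) + 1 ≤ n := by exact_mod_cast hin
  have hi0 : (0:ℝ) ≤ i := Nat.cast_nonneg i
  have f1 : ε * (i + u) ≤ ε * n := mul_le_mul_of_nonneg_left (by linarith [hu.2]) hε.le
  have f2 : 0 ≤ ε * (i + u) := by have := hu.1; positivity
  have sA : s * (arc B n t - L) ≤ 1 * (arc B n t - L) :=
    mul_le_mul_of_nonneg_right hs.2.le (by linarith)
  have sA0 : 0 ≤ s * (arc B n t - L) := mul_nonneg hs.1 (by linarith)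
  have fin : L * |θ i + u * (θ (i + 1) - θ i) - (s + θ 0)| ≤
      2 * (arc B n t - L) + 4 * n * ε := by
    rw [← abs_of_pos hLpos, ← abs_mul, abs_of_pos hLpos, abs_le]
    constructor
    · nlinarith
    · nlinarith
  have l := hα.lip (θ i + u * (θ (i + 1) - θ i)) (s + θ 0)
  have := dist_triangle (β t s) (α (θ i + u * (θ (i + 1) - θ i))) (α (s + θ 0))
  linarith

end Purs


theorem Purs.converge [CompactSpace M] {G : GeodesicStructure M} {n : ℕ} {B : ℕ → ℝ → M}
    {β : ℝ → ℝ → M} (P : Purs G n B) (hβ : Loops G n B β) :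
    ∃ (α : ℝ → M) (L : ℝ), IsClosedGeodesic α L ∧ LoopTendsto β α := by
  obtain ⟨U, α, hlim⟩ := Purs.exists_lim β
  have hL := P.arcI_pos
  have hper := Purs.lim_per hβ hlim
  have hlip := P.lim_lip hβ hlim
  obtain ⟨e, he, hloc⟩ := P.lim_iso hβ hlim
  refine ⟨α, arcI B n, ⟨hper, hL, e, he, hloc⟩, ?_⟩
  have hiso : ∀ s u, arcI B n * |s - u| < G.inj → dist (α s) (α u) = arcI B n * |s - u| :=
    fun s u h => iso_inj G P.injpos P.np hL hlip he hloc h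
  have hα : CG G α (arcI B n) := by
    refine ⟨hper, hL, hlip, hiso, ?_⟩
    intro a b u hab hu
    refine curve_geod G (fun x hx y hy => hiso x y ?_) hab hu
    refine lt_of_le_of_lt (mul_le_mul_of_nonneg_left ?_ hL.le) hab
    rw [abs_sub_comm a b]
    exact abs_sub_le_of_uIcc_subset_uIcc (uIcc_subset_uIcc hy hx)
  obtain ⟨T, J, hJ⟩ := P.exists_foll
  obtain ⟨κ, hκ0, hκi, hκ⟩ := P.bound
  intro ε₀ hε₀
  obtain ⟨ε, hε, hε1⟩ : ∃ ε, 0 < ε ∧ ε < min ((G.inj - κ) / 6) (ε₀ / 2 / (2 + 4 * n)) :=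
    exists_between (lt_min (by linarith) (by positivity))
  rw [lt_min_iff] at hε1
  obtain ⟨hεa, hεb⟩ := hε1
  rw [lt_div_iff₀ (by positivity)] at hεb
  have hev : ∀ᶠ t in (U : Filter ℝ), ∀ i ∈ Finset.range n,
      dist (B i t) (α (arcI B i / arcI B n)) < ε := (Filter.eventually_all_finset _).2 fun i _ =>
    (P.lim_bug hβ hlim i).eventually (ball_mem_nhds _ hε)
  obtain ⟨t1, hn1, ht1⟩ := (hev.and (hlim.le (eventually_ge_atTop T))).exists
  have near : ∀ i, dist (B i t1) (α (arcI B i / arcI B n)) ≤ ε := by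
    intro i
    induction i using Nat.strong_induction_on with
    | _ i ih =>
      by_cases hi : i < n
      · exact (hn1 i (Finset.mem_range.2 hi)).le
      · obtain ⟨k, rfl⟩ : ∃ k, i = k + n := ⟨i - n, by omega⟩
        rw [P.per, P.arcI_per, add_div, div_self hL.ne', hper]
        exact ih k (by have := P.npos; omega)
  have hinv : Inv B n J α (arcI B n) (κ + 4 * ε) ε t1 (fun i => arcI B i / arcI B n) := by
    refine ⟨fun i => ?_, fun i => ?_, fun i => ?_, near⟩
    · rw [P.arcI_per, add_div, div_self hL.ne']
    · rw [hJ.arc]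
    · have h1 := ellI_le B i (le_refl (0:ℝ))
      have h2 := hκ i 0 le_rfl
      have h3 := ellI_nonneg B i
      have e : arcI B i / arcI B n - arcI B (i + 1) / arcI B n = -(ellI B i / arcI B n) := by
        rw [arcI_succ]; ring
      rw [e, abs_neg, abs_of_nonneg (by positivity), mul_div_cancel₀ _ hL.ne']
      simp only [ell] at h1
      linarith
  obtain ⟨T2, hT2⟩ := eventually_atTop.1 ((P.tendsto_arc n).eventually_lt_const
    (show arcI B n < arcI B n + ε₀ / 4 by linarith))
  refine ⟨max t1 T2, fun t ht => ?_⟩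
  have htt1 := (le_max_left _ _).trans ht
  have htT2 := hT2 t ((le_max_right _ _).trans ht)
  obtain ⟨θ, hθ⟩ := P.inv_all hJ hα hκ hκ0 hε (by linarith) ht1 hinv htt1
  refine ⟨θ 0, fun s => ?_⟩
  have := P.inv_close hβ hα hκ hε (by linarith) (hJ.nonneg.trans (ht1.trans htt1)) hθ s
  nlinarith

theorem purs_of {G : GeodesicStructure M} (hinj : 0 < G.inj) (hnp : NonposCurvedOn G Set.univ)
    (n : ℕ) [NeZero n] (b : ZMod n → ℝ → M) (hb : IsCyclicPursuit G n b)
    (hne : ¬ ∃ t₀ : ℝ, 0 ≤ t₀ ∧ ∀ t, t₀ ≤ t → ∀ i, b i t = b 0 t₀) :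
    Purs G n (fun i t => b (i : ZMod n) t) := by
  refine ⟨Nat.pos_of_ne_zero (NeZero.ne n), hinj, hnp, ?_, ?_, fun i => hb.cont i, ?_, ?_, ?_⟩
  · intro i t
    simp
  · intro i
    have := hb.init_sep i
    push_cast
    exact this
  · intro i t ht hne' hlt c hc
    push_cast at hne' hlt ⊢
    have h := (hb.chase i t ht hne' (lt_injAt G _ hlt)).def hc
    have h2 := h.filter_mono (nhdsWithin_mono 0 (Ioi_subset_Ici_self))
    filter_upwards [h2, self_mem_nhdsWithin] with h h3 h4
    rw [Real.norm_of_nonneg dist_nonneg, Real.norm_of_nonneg (le_of_lt h4)] at h3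
    exact h3
  · intro i t₀ t h0 h1 h2
    push_cast at h2 ⊢
    rcases eq_or_lt_of_le h1 with h | h
    · rw [← h]; exact h2
    · exact hb.merge i t₀ h0 h2 t h
  · intro t ht
    by_contra hcon
    push Not at hcon
    have h1 : ∀ i : ℕ, b (i : ZMod n) t = b 0 t := by
      intro i
      induction i with
      | zero => simp
      | succ i ih => rw [← ih]; exact (hcon i).symm
    have h2 : ∀ i : ZMod n, b i t = b 0 t := by
      intro i
      have := h1 i.val
      rwa [ZMod.natCast_zmod_val] at this
    refine hne ⟨t, ht, fun s hs i => ?_⟩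
    rcases eq_or_lt_of_le hs with h | h
    · rw [← h]; exact h2 i
    · exact hb.halt t ht h2 s h i

theorem loops_of {G : GeodesicStructure M}
    (n : ℕ) [NeZero n] (b : ZMod n → ℝ → M)
    (P : Purs G n (fun i t => b (i : ZMod n) t))
    (β : ℝ → ℝ → M) (hβ : ∀ t : ℝ, 0 ≤ t → IsPursuitLoop G (fun i => b i t) (β t)) :
    Loops G n (fun i t => b (i : ZMod n) t) β := by
  refine ⟨fun t ht => (hβ t ht).1, ?_⟩
  intro t ht
  obtain ⟨hper, h0, σ, hσ0, hσn, hmono, hlen, hgeo⟩ := hβ t ht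
  set B : ℕ → ℝ → M := fun i t => b (i : ZMod n) t with hB
  have hA := P.arc_pos ht
  have hsum : ∑ j : ZMod n, dist (b j t) (b (j + 1) t) = arc B n t := by
    have h1 : ∑ j : ZMod n, dist (b j t) (b (j + 1) t) =
        ∑ k : Fin n, dist (b ((k : ℕ) : ZMod n) t) (b (((k : ℕ) : ZMod n) + 1) t) := by
      symm
      refine Fintype.sum_equiv (ZMod.finEquiv n).toEquiv _ _ fun k => ?_
      have : (ZMod.finEquiv n).toEquiv k = ((k : ℕ) : ZMod n) := by
        obtain ⟨m, rfl⟩ : ∃ m, n = m + 1 := Nat.exists_eq_succ_of_ne_zero (NeZero.ne n)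
        exact (Fin.cast_val_eq_self k).symm
      rw [this]
    rw [h1, Fin.sum_univ_eq_sum_range
      (fun k : ℕ => dist (b (k : ZMod n) t) (b ((k : ZMod n) + 1) t)) n]
    refine Finset.sum_congr rfl fun k _ => ?_
    simp only [ell, hB]
    push_cast
    rfl
  have hstep : ∀ i, i < n → σ (i + 1) - σ i = ell B i t / arc B n t := by
    intro i hi
    rw [eq_div_iff hA.ne', ← hsum, hlen i hi]
    simp only [ell, hB]
    push_cast
    rfl
  have hσ : ∀ i, i ≤ n → σ i = arc B i t / arc B n t := by
    intro i hi
    induction i with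
    | zero => simp [hσ0, arc]
    | succ i ih =>
      have h1 := hstep i (by omega)
      rw [ih (by omega)] at h1
      rw [arc_succ, add_div]
      linarith
  have main : ∀ i, i < n → ∀ u ∈ Icc (0:ℝ) 1,
      β t ((arc B i t + u * ell B i t) / arc B n t) = G.geod (B i t) (B (i + 1) t) u := by
    intro i hi u hu
    have hl : 0 ≤ ell B i t := dist_nonneg
    have hst := hstep i hi
    have hσi := hσ i hi.le
    have e1 : (arc B i t + u * ell B i t) / arc B n t = σ i + u * (σ (i + 1) - σ i) := by
      rw [hst, hσi]; ring
    have hd : 0 ≤ σ (i + 1) - σ i := by rw [hst]; positivity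
    have hg := hgeo i hi (σ i + u * (σ (i + 1) - σ i))
      ⟨by nlinarith [hu.1], by nlinarith [hu.2]⟩
    have eB : B (i + 1) t = b ((i : ZMod n) + 1) t := by simp only [hB]; push_cast; rfl
    rw [e1, hg, eB]
    simp only [hB]
    rcases eq_or_lt_of_le hl with h | h
    · have heq : b (i : ZMod n) t = b ((i : ZMod n) + 1) t := by
        rw [← eB]; exact dist_eq_zero.1 h.symm
      rw [← heq, hst, ← h]
      simp only [zero_div, div_zero]
      rw [geod_self G P.injpos _ hu, geod_self G P.injpos _ (by simp)]
    · have hd' : 0 < σ (i + 1) - σ i := by rw [hst]; positivity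
      congr 1
      field_simp
      ring
  intro i
  induction i using Nat.strong_induction_on with
  | _ i ih =>
    intro u hu
    by_cases hi : i < n
    · exact main i hi u hu
    · obtain ⟨k, rfl⟩ : ∃ k, i = k + n := ⟨i - n, by omega⟩
      have hn := P.npos
      have h1 := ih k (by omega) u hu
      rw [P.ell_per, P.arc_per]
      have e : (arc B k t + arc B n t + u * ell B k t) / arc B n t =
          (arc B k t + u * ell B k t) / arc B n t + 1 := by
        field_simp
        ring
      rw [e, hper, h1]
      simp


end PursuitAux

/-- Main Theorem. Let `M` be a compact Riemannian manifold of
nonpositive sectional curvature.  Suppose cyclic pursuit on `M` does not end in finite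
time, and let `β t` be the associated family of piecewise geodesic loops.  Then there is
a closed geodesic `α : ℝ/ℤ → M` such that `β t → α` as `t → ∞`, i.e.
`inf_c sup_s d (β t s) (α (s+c)) → 0`.  (Equivalently: the loop of bugs either collapses
to a point in finite time or converges to a closed geodesic.) -/
theorem riemannian_pursuit_nonpos_curvature_converges_to_closed_geodesic
    {M : Type*} [MetricSpace M] [CompactSpace M]
    (G : GeodesicStructure M) (hinj : 0 < G.inj)
    (hnp : NonposCurvedOn G Set.univ)
    (n : ℕ) [NeZero n] (b : ZMod n → ℝ → M) (hb : IsCyclicPursuit G n b)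
    (β : ℝ → ℝ → M) (hβ : ∀ t : ℝ, 0 ≤ t → IsPursuitLoop G (fun i => b i t) (β t))
    (hne : ¬ ∃ t₀ : ℝ, 0 ≤ t₀ ∧ ∀ t, t₀ ≤ t → ∀ i, b i t = b 0 t₀) :
    ∃ (α : ℝ → M) (L : ℝ), IsClosedGeodesic α L ∧ LoopTendsto β α := by
  have P := PursuitAux.purs_of hinj hnp n b hb hne
  exact P.converge (PursuitAux.loops_of n b P β hβ)
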